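/- arXiv:2008.00306 — 7 statements merged into one kernel-verified Lean document; each statement's English description precedes it below -/
import Mathlib

section
/- Let f be a non wandering homeomorphism of a topological space S. Then for every nonempty open set U ⊆ S and every integer q ≥ 1 there exists a strictly increasing sequence of natural numbers 0 = n_0 < n_1 < ... < n_q such that the intersection ⋂_{0 ≤ i ≤ q} f^{-n_i}(U) is nonempty. -/
open Filter Set Topology

/-- A homeomorphism (or more generally a map) `f` of a topological space `S` is
*non wandering* if for every nonempty open set `U ⊆ S` there exists an integer
`n ≥ 1` such that `U ∩ f^{-n}(U) ≠ ∅`. -/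
def IsNonWandering {S : Type*} [TopologicalSpace S] (f : S → S) : Prop :=
  ∀ U : Set S, IsOpen U → U.Nonempty → ∃ n : ℕ, 1 ≤ n ∧ (U ∩ f^[n] ⁻¹' U).Nonempty

/-- Lemma 2.1: if `f` is a non wandering homeomorphism of a topological space `S`,
then for every nonempty open set `U ⊆ S` and every `q ≥ 1` there is a strictly
increasing sequence `0 = n_0 < n_1 < ⋯ < n_q` of natural numbers with
`⋂_{0 ≤ i ≤ q} f^{-n_i}(U) ≠ ∅`. -/
theorem nonwandering_iterated_intersection {S : Type*} [TopologicalSpace S]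
    (f : S ≃ₜ S) (hf : IsNonWandering ⇑f)
    (U : Set S) (hUopen : IsOpen U) (hUne : U.Nonempty) (q : ℕ) (hq : 1 ≤ q) :
    ∃ n : ℕ → ℕ, n 0 = 0 ∧ (∀ i < q, n i < n (i + 1)) ∧
      (⋂ i ∈ Finset.range (q + 1), (⇑f)^[n i] ⁻¹' U).Nonempty := by
  clear hq
  induction q generalizing U with
  | zero =>
    obtain ⟨x, hx⟩ := hUne
    exact ⟨fun _ => 0, rfl, by simp, x, by simpa using hx⟩
  | succ q ih =>
    obtain ⟨m, hm, hne⟩ := hf U hUopen hUne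
    have hopen : IsOpen (U ∩ (⇑f)^[m] ⁻¹' U) :=
      hUopen.inter (hUopen.preimage (f.continuous.iterate m))
    obtain ⟨n, h0, hlt, x, hx⟩ := ih _ hopen hne
    simp only [mem_iInter, Finset.mem_range] at hx
    refine ⟨fun i => Nat.casesOn i 0 (fun j => m + n j), rfl, ?_, x, ?_⟩
    · intro i hi
      cases i with
      | zero => show 0 < m + n 0; omega
      | succ j =>
        have := hlt j (by omega)
        show m + n j < m + n (j + 1)
        omega
    · simp only [mem_iInter, Finset.mem_range]
      intro i hi
      cases i with
      | zero =>
        have := (hx 0 (by omega)).1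
        rw [h0] at this
        exact this
      | succ j =>
        have := (hx j (by omega)).2
        show (⇑f)^[m + n j] x ∈ U
        rw [Function.iterate_add_apply]
        exact this
end

section
/- Let f be a non wandering homeomorphism of a topological space S. Then for every integer k ∈ ℤ, the power f^k is a non wandering homeomorphism of S. -/
open Filter Set Topology

theorem exists_return_times {S : Type*} [TopologicalSpace S] {f : S → S} (hc : Continuous f)
    (hf : IsNonWandering f) (m : ℕ) : ∀ U : Set S, IsOpen U → U.Nonempty →
    ∃ x ∈ U, ∃ T : Finset ℕ, T.card = m ∧ ∀ t ∈ T, f^[t] x ∈ U := by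
  induction m with
  | zero =>
    rintro U - ⟨x, hx⟩
    exact ⟨x, hx, ∅, rfl, by simp⟩
  | succ m ih =>
    intro U hU hne
    obtain ⟨n, hn, hV⟩ := hf U hU hne
    obtain ⟨x, hx, T, hT, h⟩ := ih _ (hU.inter (hU.preimage (hc.iterate n))) hV
    refine ⟨x, hx.1, insert 0 (T.image (fun t => n + t)), ?_, ?_⟩
    · rw [Finset.card_insert_of_notMem, Finset.card_image_of_injective _ (add_right_injective n), hT]
      simp only [Finset.mem_image, not_exists, not_and]
      intro t _
      omega
    · intro t ht
      rcases Finset.mem_insert.1 ht with rfl | ht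
      · exact hx.1
      · obtain ⟨r, hr, rfl⟩ := Finset.mem_image.1 ht
        rw [Function.iterate_add_apply]
        exact (h r hr).2

theorem IsNonWandering.iterate_map {S : Type*} [TopologicalSpace S] {f : S → S} (hc : Continuous f)
    (hf : IsNonWandering f) (k : ℕ) : IsNonWandering f^[k] := by
  intro U hU hne
  rcases Nat.eq_zero_or_pos k with rfl | hk
  · obtain ⟨x, hx⟩ := hne
    exact ⟨1, le_rfl, x, hx, by simpa using hx⟩
  obtain ⟨x, hx, T, hT, h⟩ := exists_return_times hc hf (k + 1) U hU hne
  obtain ⟨a, ha, b, hb, hab, hmod⟩ := Finset.exists_ne_map_eq_of_card_lt_of_maps_to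
    (s := T) (t := Finset.range k) (f := fun t => t % k) (by simp [hT])
    (fun t _ => by simpa using Nat.mod_lt t hk)
  have key : ∀ a ∈ T, ∀ b ∈ T, a < b → a % k = b % k →
      ∃ n : ℕ, 1 ≤ n ∧ (U ∩ (f^[k])^[n] ⁻¹' U).Nonempty := by
    intro a ha b hb hlt hm
    obtain ⟨q, hq⟩ := (Nat.modEq_iff_dvd' hlt.le).1 hm
    refine ⟨q, ?_, f^[a] x, h a ha, ?_⟩
    · rcases Nat.eq_zero_or_pos q with rfl | h'
      · omega
      · exact h'
    · rw [← Function.iterate_mul, mem_preimage, ← Function.iterate_add_apply, ← hq,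
        Nat.sub_add_cancel hlt.le]
      exact h b hb
  rcases lt_or_gt_of_ne hab with hl | hl
  · exact key a ha b hb hl hmod
  · exact key b hb a ha hl hmod.symm

theorem nonwandering_symm {S : Type*} [TopologicalSpace S] (f : S ≃ₜ S)
    (hf : IsNonWandering ⇑f) : IsNonWandering ⇑f.symm := by
  intro U hU hne
  obtain ⟨n, hn, x, hx, hx'⟩ := hf U hU hne
  refine ⟨n, hn, f^[n] x, hx', ?_⟩
  have hl : Function.LeftInverse f.symm f := f.symm_apply_apply
  rw [mem_preimage, hl.iterate n x]
  exact hx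

theorem nonwandering_npow {S : Type*} [TopologicalSpace S]
    (f : S ≃ₜ S) (hf : IsNonWandering ⇑f) (k : ℕ) :
    ∃ g : S ≃ₜ S, g.toEquiv = f.toEquiv ^ k ∧ IsNonWandering ⇑g := by
  have e1 : ⇑(f.toEquiv ^ k : Equiv.Perm S) = f^[k] := (Equiv.Perm.iterate_eq_pow f.toEquiv k).symm
  have e2 : ⇑(f.toEquiv ^ k : Equiv.Perm S).symm = f.symm^[k] := by
    change ⇑((f.toEquiv ^ k : Equiv.Perm S)⁻¹) = _
    rw [← inv_pow]
    exact (Equiv.Perm.iterate_eq_pow f.toEquiv.symm k).symm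
  refine ⟨⟨f.toEquiv ^ k, ?_, ?_⟩, rfl, ?_⟩
  · change Continuous ⇑(f.toEquiv ^ k : Equiv.Perm S)
    rw [e1]
    exact f.continuous.iterate k
  · change Continuous ⇑(f.toEquiv ^ k : Equiv.Perm S).symm
    rw [e2]
    exact f.symm.continuous.iterate k
  · change IsNonWandering ⇑(f.toEquiv ^ k : Equiv.Perm S)
    rw [e1]
    exact hf.iterate_map f.continuous k

/-- Proposition 2.2 (1): if `f` is a non wandering homeomorphism of a topological
space `S`, then for every `k ∈ ℤ` the power `f^k` is a non wandering homeomorphism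
of `S`.  (The integer power `f^k` is computed in the group of permutations of `S`;
the conclusion asserts that it is again a homeomorphism and that it is non
wandering.) -/
theorem nonwandering_zpow {S : Type*} [TopologicalSpace S]
    (f : S ≃ₜ S) (hf : IsNonWandering ⇑f) (k : ℤ) :
    ∃ g : S ≃ₜ S, g.toEquiv = f.toEquiv ^ k ∧ IsNonWandering ⇑g := by
  obtain ⟨n, rfl | rfl⟩ := k.eq_nat_or_neg
  · simpa using nonwandering_npow f hf n
  · obtain ⟨g, hg, hw⟩ := nonwandering_npow f.symm (nonwandering_symm f hf) n
    refine ⟨g, ?_, hw⟩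
    rw [hg, zpow_neg, zpow_natCast, ← inv_pow]
    rfl
end

section
/- Let S be a connected topological space, let π : Ŝ → S be a covering map all of whose fibers are finite, let f be a non wandering homeomorphism of S, and let f̂ be a homeomorphism of Ŝ satisfying π ∘ f̂ = f ∘ π (a lift of f). Then f̂ is non wandering. -/
open Filter Set Topology

/-- Points returning to `V` at arbitrarily many different times. -/
theorem exists_many_returns {S : Type*} [TopologicalSpace S] (f : S → S) (hc : Continuous f)
    (hf : IsNonWandering f) (V : Set S) (hV : IsOpen V) (hne : V.Nonempty) (k : ℕ) :
    ∃ T : Finset ℕ, 0 ∈ T ∧ k < T.card ∧ ∃ x, ∀ m ∈ T, f^[m] x ∈ V := by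
  induction k with
  | zero =>
    obtain ⟨x, hx⟩ := hne
    exact ⟨{0}, by simp, by simp, x, by simpa using hx⟩
  | succ k ih =>
    obtain ⟨T, h0, hk, x, hx⟩ := ih
    have hopen : IsOpen (⋂ m ∈ T, f^[m] ⁻¹' V) :=
      isOpen_biInter_finset fun m _ => hV.preimage (hc.iterate m)
    obtain ⟨n, hn, y, hy1, hy2⟩ := hf _ hopen ⟨x, by simpa using hx⟩
    simp only [mem_iInter, mem_preimage] at hy1 hy2
    refine ⟨insert (T.max' ⟨0, h0⟩ + n) T, by simp [h0], ?_, y, ?_⟩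
    · rw [Finset.card_insert_of_notMem]
      · omega
      · intro hmem
        have := T.le_max' _ hmem
        omega
    · intro m hm
      rcases Finset.mem_insert.1 hm with rfl | hm
      · rw [Function.iterate_add_apply]
        exact hy2 _ (T.max'_mem _)
      · exact hy1 m hm

/-- Proposition 2.2 (2): let `S` be a connected topological space, `π : Ŝ → S` a
covering map all of whose fibers are finite, `f` a non wandering homeomorphism of
`S` and `fhat` a lift of `f` to `Ŝ` (i.e. `π ∘ fhat = f ∘ π`).  Then `fhat` is non
wandering. -/
theorem nonwandering_lift_finite_cover {S Shat : Type*}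
    [TopologicalSpace S] [TopologicalSpace Shat] [ConnectedSpace S]
    (π : Shat → S) (hπ : IsCoveringMap π) (hfin : ∀ x : S, (π ⁻¹' {x}).Finite)
    (f : S ≃ₜ S) (hf : IsNonWandering ⇑f)
    (fhat : Shat ≃ₜ Shat) (hlift : π ∘ ⇑fhat = ⇑f ∘ π) :
    IsNonWandering ⇑fhat := by
  intro U hU hne
  obtain ⟨u, hu⟩ := hne
  obtain ⟨-, W, hxW, hW, hpW, H, hH⟩ := hπ (π u)
  have : Fintype (π ⁻¹' {π u}) := (hfin (π u)).fintype
  have hVo : IsOpen (π '' (U ∩ π ⁻¹' W)) := hπ.isOpenMap _ (hU.inter hpW)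
  obtain ⟨T, h0, hk, x, hx⟩ := exists_many_returns f f.continuous hf _ hVo
    ⟨π u, u, ⟨hu, hxW⟩, rfl⟩ (Fintype.card (π ⁻¹' {π u}))
  have hxW' : x ∈ W := by
    obtain ⟨z, hz, hzx⟩ := hx 0 h0
    have hzx' : π z = x := hzx
    rw [← hzx']
    exact hz.2
  have hsemi : ∀ n z, π (fhat^[n] z) = f^[n] (π z) := fun n z =>
    (Function.Semiconj.iterate_right (f := π) (fun z => congrFun hlift z) n) z
  have hz : ∀ m : T, ∃ z, fhat^[m] z ∈ U ∧ π z = x := by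
    rintro ⟨m, hm⟩
    obtain ⟨y, hy, hyx⟩ := hx m hm
    obtain ⟨z, rfl⟩ := fhat.surjective.iterate m y
    exact ⟨z, hy.1, f.injective.iterate m (by rw [← hsemi, hyx])⟩
  choose z hzU hzx using hz
  have hzW : ∀ m, z m ∈ π ⁻¹' W := fun m => by simpa [hzx m] using hxW'
  obtain ⟨a, b, hab, he⟩ := Fintype.exists_ne_map_eq_of_card_lt
    (fun m : T => (H ⟨z m, hzW m⟩).2) (by simpa using hk)
  have hzz : z a = z b := by
    have : H ⟨z a, hzW a⟩ = H ⟨z b, hzW b⟩ :=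
      Prod.ext (Subtype.ext (by rw [hH, hH]; simp [hzx])) he
    exact congrArg Subtype.val (H.injective this)
  have key : ∀ a b : T, (a : ℕ) < b → z a = z b →
      ∃ n : ℕ, 1 ≤ n ∧ (U ∩ fhat^[n] ⁻¹' U).Nonempty := by
    intro a b hlt h
    refine ⟨b - a, by omega, fhat^[a] (z a), hzU a, ?_⟩
    rw [mem_preimage, ← Function.iterate_add_apply, Nat.sub_add_cancel hlt.le, h]
    exact hzU b
  rcases lt_or_gt_of_ne (fun h => hab (Subtype.ext h) : (a : ℕ) ≠ b) with h | h
  · exact key a b h hzz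
  · exact key b a h hzz.symm
end

section
/- Let f be a non wandering homeomorphism of a compact metric space S (in the paper, a closed surface), let π : Ŝ → S be a covering map, and let f̂ be a homeomorphism of Ŝ satisfying π ∘ f̂ = f ∘ π. If Û ⊆ Ŝ is a nonempty open set that is wandering for f̂, then neither ⋃_{n ≥ 0} f̂^n(Û) nor ⋃_{n ≥ 0} f̂^{-n}(Û) has compact closure in Ŝ. -/
open Filter Set Topology

theorem isLocallyInjective_iff_nhds_aux {S Shat : Type*}
    [TopologicalSpace S] [TopologicalSpace Shat]
    (π : Shat → S) (hπ : IsCoveringMap π) (x : Shat) :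
    ∃ W : Set Shat, IsOpen W ∧ x ∈ W ∧ InjOn π W :=
  hπ.isLocalHomeomorph.isLocallyInjective x

theorem exists_recurrent_aux {S : Type*} [MetricSpace S] [CompactSpace S] (f : S ≃ₜ S)
    (hf : IsNonWandering ⇑f) (V : Set S) (hV : IsOpen V) (hVne : V.Nonempty) :
    ∃ p ∈ V, ∀ W ∈ 𝓝 p, ∃ n : ℕ, 1 ≤ n ∧ (⇑f)^[n] p ∈ W := by
  let O : ℕ → Set S := fun k => ⋃ n : ℕ, {p | 1 ≤ n ∧ dist ((⇑f)^[n] p) p < 1 / ((k : ℝ) + 1)}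
  have hO : ∀ k, IsOpen (O k) := by
    intro k
    refine isOpen_iUnion fun n => ?_
    by_cases hn : 1 ≤ n
    · simp only [hn, true_and]
      exact isOpen_lt ((f.continuous.iterate n).dist continuous_id) continuous_const
    · simp [hn]
  have hD : ∀ k, Dense (O k) := by
    intro k
    rw [dense_iff_inter_open]
    rintro W hW ⟨c, hc⟩
    have hpos : (0 : ℝ) < 1 / ((k : ℝ) + 1) := by positivity
    obtain ⟨n, hn, q, ⟨hq1, hq2⟩, hq3, hq4⟩ := hf (W ∩ Metric.ball c (1 / ((k : ℝ) + 1) / 2))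
      (hW.inter Metric.isOpen_ball) ⟨c, hc, Metric.mem_ball_self (by positivity)⟩
    refine ⟨q, hq1, mem_iUnion.2 ⟨n, hn, ?_⟩⟩
    rw [Metric.mem_ball] at hq2 hq4
    have := dist_triangle_right ((⇑f)^[n] q) q c
    linarith
  have hden := dense_iInter_of_isOpen hO hD
  obtain ⟨p, hpV, hp⟩ := hden.inter_open_nonempty V hV hVne
  refine ⟨p, hpV, fun W hW => ?_⟩
  obtain ⟨ε, hε, hsub⟩ := Metric.mem_nhds_iff.1 hW
  obtain ⟨k, hk⟩ := exists_nat_one_div_lt hε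
  obtain ⟨n, hn, hd⟩ := mem_iUnion.1 (mem_iInter.1 hp k)
  exact ⟨n, hn, hsub (Metric.mem_ball.2 (hd.trans hk))⟩

theorem forward_aux {S Shat : Type*}
    [MetricSpace S] [CompactSpace S] [TopologicalSpace Shat]
    (π : Shat → S) (hπ : IsCoveringMap π)
    (f : S ≃ₜ S) (hf : IsNonWandering ⇑f)
    (fhat : Shat ≃ₜ Shat) (hlift : π ∘ ⇑fhat = ⇑f ∘ π)
    (U : Set Shat) (hUopen : IsOpen U) (hUne : U.Nonempty)
    (hUw : ∀ n : ℕ, 1 ≤ n → U ∩ (⇑fhat)^[n] ⁻¹' U = ∅) :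
    ¬ IsCompact (closure (⋃ n : ℕ, (⇑fhat)^[n] '' U)) := by
  intro hK
  set K := closure (⋃ n : ℕ, (⇑fhat)^[n] '' U) with hKdef
  have hsemi : ∀ n y, π ((⇑fhat)^[n] y) = (⇑f)^[n] (π y) := by
    intro n y
    have h : Function.Semiconj π fhat f := fun z => congrFun hlift z
    exact (h.iterate_right n) y
  obtain ⟨p, ⟨x, hxU, hxp⟩, hp⟩ := exists_recurrent_aux f hf (π '' U)
    (hπ.isOpenMap U hUopen) (hUne.image π)
  have hxK : x ∈ K := subset_closure (mem_iUnion.2 ⟨0, x, hxU, rfl⟩)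
  have hKmaps : ∀ n, MapsTo (⇑fhat)^[n] K K := by
    intro n
    refine MapsTo.closure ?_ (fhat.continuous.iterate n)
    intro y hy
    obtain ⟨m, z, hz, rfl⟩ := mem_iUnion.1 hy
    exact mem_iUnion.2 ⟨n + m, z, hz, by rw [Function.iterate_add_apply]⟩
  let F : Filter ℕ := 𝓟 {n | 1 ≤ n} ⊓ comap (fun n => (⇑f)^[n] p) (𝓝 p)
  have hF : F.NeBot := by
    change (𝓟 {n | 1 ≤ n} ⊓ comap (fun n => (⇑f)^[n] p) (𝓝 p)).NeBot
    rw [inf_comm]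
    refine (inf_principal_neBot_iff).2 ?_
    rintro T ⟨W, hW, hWT⟩
    obtain ⟨n, hn, hnW⟩ := hp W hW
    exact ⟨n, hWT hnW, hn⟩
  let G : Ultrafilter ℕ := Ultrafilter.of F
  have hGF : (G : Filter ℕ) ≤ F := Ultrafilter.of_le F
  have hG1 : ∀ᶠ n in (G : Filter ℕ), 1 ≤ n := hGF (mem_inf_of_left (mem_principal_self _))
  have hG2 : Tendsto (fun n => (⇑f)^[n] p) G (𝓝 p) :=
    tendsto_comap.mono_left (hGF.trans inf_le_right)
  let A : Set Shat := K ∩ π ⁻¹' {p}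
  have hAfin : A.Finite := by
    have hc : IsCompact A := hK.inter_right (isClosed_singleton.preimage hπ.continuous)
    have hdisc : DiscreteTopology (π ⁻¹' {p}) := (hπ p).discreteTopology_fiber
    exact hc.finite (IsDiscrete.mono ⟨hdisc⟩ inter_subset_right)
  have hlim : ∀ a : A, ∃ b : A, Tendsto (fun n => (⇑fhat)^[n] a.1) G (𝓝 b.1) := by
    rintro ⟨a, haK, hap⟩
    obtain ⟨b, hbK, hb⟩ := hK.ultrafilter_le_nhds (G.map (fun n => (⇑fhat)^[n] a))
      (le_principal_iff.2 (Filter.mem_map.2 (Filter.univ_mem' fun n => hKmaps n haK)))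
    have hb' : Tendsto (fun n => (⇑fhat)^[n] a) G (𝓝 b) := hb
    refine ⟨⟨b, hbK, ?_⟩, hb'⟩
    have h1 := (hπ.continuous.tendsto b).comp hb'
    have h2 : π ∘ (fun n => (⇑fhat)^[n] a) = fun n => (⇑f)^[n] p := by
      funext n
      simp only [Function.comp, hsemi]
      rw [show π a = p from hap]
    rw [h2] at h1
    exact tendsto_nhds_unique h1 hG2
  choose σ hσ using hlim
  have hinj : Function.Injective σ := by
    intro a b hab
    have ha := hσ a
    have hb := hσ b
    rw [← hab] at hb
    obtain ⟨W, hW, hcW, hWinj⟩ := (isLocallyInjective_iff_nhds_aux π hπ) (σ a).1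
    have hWn := hW.mem_nhds hcW
    obtain ⟨n, hn1, hn2⟩ := ((ha.eventually_mem hWn).and (hb.eventually_mem hWn)).exists
    have heq := hWinj hn1 hn2 (by
      rw [hsemi, hsemi, show π a.1 = p from a.2.2, show π b.1 = p from b.2.2])
    exact Subtype.ext (fhat.injective.iterate n heq)
  have hRσ : ∀ (m : ℕ) (a : A), ∀ W : Set Shat, IsOpen W → (σ^[m + 1] a).1 ∈ W →
      ∃ n, 1 ≤ n ∧ (⇑fhat)^[n] a.1 ∈ W := by
    intro m
    induction m with
    | zero =>
      intro a W hW ha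
      obtain ⟨n, hn1, hn2⟩ := (hG1.and (hσ a (hW.mem_nhds ha) :
        ∀ᶠ n in (G : Filter ℕ), (⇑fhat)^[n] a.1 ∈ W)).exists
      exact ⟨n, hn1, hn2⟩
    | succ m ih =>
      intro a W hW ha
      rw [Function.iterate_succ_apply] at ha
      obtain ⟨n, hn, hnW⟩ := ih (σ a) W hW ha
      obtain ⟨k, hk⟩ := ((hσ a).eventually_mem
        ((hW.preimage (fhat.continuous.iterate n)).mem_nhds hnW)).exists
      refine ⟨n + k, by omega, ?_⟩
      rw [Function.iterate_add_apply]
      exact hk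
  have : Finite A := hAfin
  obtain ⟨m, hm, hper⟩ := hinj.mem_periodicPts ⟨x, hxK, hxp⟩
  obtain ⟨m, rfl⟩ : ∃ k, m = k + 1 := ⟨m - 1, by omega⟩
  obtain ⟨n, hn, hnU⟩ := hRσ m ⟨x, hxK, hxp⟩ U hUopen (by rw [hper.eq]; exact hxU)
  have : x ∈ U ∩ (⇑fhat)^[n] ⁻¹' U := ⟨hxU, hnU⟩
  rw [hUw n hn] at this
  exact this

theorem nonempty_symm_aux {S : Type*} [TopologicalSpace S] (f : S ≃ₜ S) (n : ℕ) (U : Set S)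
    (h : (U ∩ (⇑f)^[n] ⁻¹' U).Nonempty) : (U ∩ (⇑f.symm)^[n] ⁻¹' U).Nonempty := by
  obtain ⟨q, hq1, hq2⟩ := h
  refine ⟨(⇑f)^[n] q, hq2, ?_⟩
  have : (⇑f.symm)^[n] ((⇑f)^[n] q) = q :=
    (Function.LeftInverse.iterate f.symm_apply_apply n) q
  rw [mem_preimage, this]
  exact hq1

/-- Proposition 2.3: let `f` be a non wandering homeomorphism of a compact metric
space `S`, let `π : Ŝ → S` be a covering map and `fhat` a lift of `f` to `Ŝ`.
If `U ⊆ Ŝ` is a nonempty open set that is wandering for `fhat` (i.e.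
`U ∩ fhat^{-n}(U) = ∅` for all `n ≥ 1`), then neither `⋃_{n ≥ 0} fhat^n(U)`
nor `⋃_{n ≥ 0} fhat^{-n}(U)` has compact closure. -/
theorem wandering_orbit_not_relatively_compact {S Shat : Type*}
    [MetricSpace S] [CompactSpace S] [TopologicalSpace Shat]
    (π : Shat → S) (hπ : IsCoveringMap π)
    (f : S ≃ₜ S) (hf : IsNonWandering ⇑f)
    (fhat : Shat ≃ₜ Shat) (hlift : π ∘ ⇑fhat = ⇑f ∘ π)
    (U : Set Shat) (hUopen : IsOpen U) (hUne : U.Nonempty)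
    (hUwandering : ∀ n : ℕ, 1 ≤ n → U ∩ (⇑fhat)^[n] ⁻¹' U = ∅) :
    ¬ IsCompact (closure (⋃ n : ℕ, (⇑fhat)^[n] '' U)) ∧
      ¬ IsCompact (closure (⋃ n : ℕ, (⇑fhat.symm)^[n] '' U)) := by
  refine ⟨forward_aux π hπ f hf fhat hlift U hUopen hUne hUwandering,
    forward_aux π hπ f.symm ?_ fhat.symm ?_ U hUopen hUne ?_⟩
  · intro V hV hVne
    obtain ⟨n, hn, h⟩ := hf V hV hVne
    exact ⟨n, hn, nonempty_symm_aux f n V h⟩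
  · funext y
    have h := congrFun hlift (fhat.symm y)
    simp only [Function.comp, Homeomorph.apply_symm_apply] at h ⊢
    rw [h, Homeomorph.symm_apply_apply]
  · intro n hn
    by_contra hne
    have h := nonempty_symm_aux fhat.symm n U (nonempty_iff_ne_empty.2 hne)
    rw [Homeomorph.symm_symm, hUwandering n hn] at h
    exact not_nonempty_empty h
end

section
/- Let f ∈ Homeo_*(Ã) where Ã = ℝ × [0,1]. Suppose λ_0, λ'_0 ∈ Ẽ_0, λ_1, λ'_1 ∈ Ẽ_1 and integers n ≥ 1, n' ≥ 1 satisfy: f^n(λ_0) ∩ λ_1 ≠ ∅; f^{n'}(λ'_0) ∩ λ'_1 ≠ ∅; f^n(λ_0) ≺ λ'_0; λ'_1 ≺ f^{n'}(λ_1); and λ'_0 ∩ λ_1 = ∅. Then f^{n+n'}(λ_0) ∩ λ'_1 ≠ ∅. -/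
open Filter Set Topology

/-- The closed strip `Ã = ℝ × [0,1]`. -/
abbrev StripA : Type := ℝ × (Set.Icc (0:ℝ) 1)

/-- The point `0` of `[0,1]`. -/
def zeroI : Set.Icc (0:ℝ) 1 := ⟨0, by norm_num⟩

/-- The point `1` of `[0,1]`. -/
def oneI : Set.Icc (0:ℝ) 1 := ⟨1, by norm_num⟩

/-- `Homeo_*(Ã)`: homeomorphisms of the strip `Ã = ℝ × [0,1]` leaving each of the
two boundary lines invariant, whose restriction to each boundary line is
increasing in the first coordinate (orientation preserving). -/
structure IsHomeoStar (f : StripA ≃ₜ StripA) : Prop where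
  maps_bot : ∀ x : ℝ, (f (x, zeroI)).2 = zeroI
  maps_top : ∀ x : ℝ, (f (x, oneI)).2 = oneI
  mono_bot : StrictMono fun x : ℝ => (f (x, zeroI)).1
  mono_top : StrictMono fun x : ℝ => (f (x, oneI)).1

/-- An element of `Ẽ_0`: a line (proper injective continuous map) of the open
strip `ℝ × (0,1)` with two distinct ends `(endNeg, 0) ≠ (endPos, 0)` on the lower
boundary line `ℝ × {0}`. -/
structure E0Line where
  toFun : ℝ → StripA
  continuous : Continuous toFun
  injective : Function.Injective toFun
  mem_interior : ∀ t : ℝ, 0 < ((toFun t).2 : ℝ) ∧ ((toFun t).2 : ℝ) < 1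
  endNeg : ℝ
  endPos : ℝ
  ends_ne : endNeg ≠ endPos
  tendsto_neg : Tendsto toFun atBot (𝓝 (endNeg, zeroI))
  tendsto_pos : Tendsto toFun atTop (𝓝 (endPos, zeroI))

/-- An element of `Ẽ_1`: a line of the open strip `ℝ × (0,1)` with two distinct
ends on the upper boundary line `ℝ × {1}`. -/
structure E1Line where
  toFun : ℝ → StripA
  continuous : Continuous toFun
  injective : Function.Injective toFun
  mem_interior : ∀ t : ℝ, 0 < ((toFun t).2 : ℝ) ∧ ((toFun t).2 : ℝ) < 1
  endNeg : ℝ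
  endPos : ℝ
  ends_ne : endNeg ≠ endPos
  tendsto_neg : Tendsto toFun atBot (𝓝 (endNeg, oneI))
  tendsto_pos : Tendsto toFun atTop (𝓝 (endPos, oneI))

/-- The relation `≺` on lines-with-ends: `(s, a, b) ≺ (s', a', b')` if the sets
`s` and `s'` are disjoint, the smallest end of the first is smaller than the
smallest end of the second, and likewise for the highest ends. -/
def PrecData (s : Set StripA) (a b : ℝ) (s' : Set StripA) (a' b' : ℝ) : Prop :=
  s ∩ s' = ∅ ∧ min a b < min a' b' ∧ max a b < max a' b'

/-- Two continuous lifts argument: increments of a continuous logarithm along a path that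
stays in a rotated slit plane. -/
lemma edge_log (L h : ℝ → ℂ) (hL : Continuous L) (hh : Continuous h)
    (he : ∀ x, Complex.exp (L x) = h x) (c : ℂ) (hc : ∀ x, c * h x ∈ Complex.slitPlane) :
    L 1 - L 0 = Complex.log (c * h 1) - Complex.log (c * h 0) := by
  have key : ∀ x, Complex.exp (L x - Complex.log (c * h x)) = c⁻¹ := by
    intro x
    have h0 := Complex.slitPlane_ne_zero (hc x)
    rw [Complex.exp_sub, he, Complex.exp_log h0]
    have hc0 : c ≠ 0 := left_ne_zero_of_mul h0
    have hh0 : h x ≠ 0 := right_ne_zero_of_mul h0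
    field_simp
  have hD : Continuous fun x => L x - Complex.log (c * h x) :=
    hL.sub ((continuous_const.mul hh).clog hc)
  have := Complex.isCoveringMap_exp.eq_of_comp_eq hD
    (continuous_const (y := L 0 - Complex.log (c * h 0)))
    (by
      funext x
      apply Subtype.ext
      simp only [Function.comp]
      rw [key, key]) 0 rfl
  have h1 := congrFun this 1
  linear_combination h1

lemma slit_up {z : ℂ} (h0 : z ≠ 0) (h : 0 ≤ z.im) : (-Complex.I) * z ∈ Complex.slitPlane := by
  rw [Complex.mem_slitPlane_iff]
  simp only [Complex.mul_re, Complex.mul_im, Complex.neg_re, Complex.neg_im, Complex.I_re,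
    Complex.I_im]
  by_cases hz : z.im = 0
  · right
    intro hr
    apply h0
    apply Complex.ext
    · simp; linarith
    · simpa using hz
  · left
    have : 0 < z.im := lt_of_le_of_ne h (Ne.symm hz)
    linarith

lemma slit_down {z : ℂ} (h0 : z ≠ 0) (h : z.im ≤ 0) : Complex.I * z ∈ Complex.slitPlane := by
  have := slit_up (z := -z) (by simpa using h0) (by simpa using h)
  simpa using this

/-- Two crossing curves in a horizontal strip meet. -/
lemma crossing_complex (p q : ℝ → ℂ) (hp : Continuous p) (hq : Continuous q)
    (hp0 : ∀ t, 0 ≤ (p t).im) (hp1 : ∀ t, (p t).im ≤ 1)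
    (hq0 : ∀ t, 0 ≤ (q t).im) (hq1 : ∀ t, (q t).im ≤ 1)
    (a b c d : ℝ) (hab : a < b) (hcd : c < d)
    (ep0 : p 0 = ⟨a, 0⟩) (ep1 : p 1 = ⟨d, 1⟩) (eq0 : q 0 = ⟨b, 0⟩) (eq1 : q 1 = ⟨c, 1⟩) :
    ∃ s t, p s = q t := by
  by_contra! hne
  let H : C(ℝ × ℝ, {z : ℂ // z ≠ 0}) :=
    ⟨fun x => ⟨p x.1 - q x.2, sub_ne_zero.2 (hne _ _)⟩, by fun_prop⟩
  obtain ⟨L, ⟨-, hL⟩, -⟩ := Complex.isCoveringMap_exp.existsUnique_continuousMap_lifts H (0, 0)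
    (Complex.log (p 0 - q 0)) (by
      apply Subtype.ext
      exact Complex.exp_log (sub_ne_zero.2 (hne _ _)))
  have hE : ∀ s t, Complex.exp (L (s, t)) = p s - q t := fun s t =>
    congrArg Subtype.val (congrFun hL (s, t))
  have hz : ∀ s t, p s - q t ≠ 0 := fun s t => sub_ne_zero.2 (hne _ _)
  have e1 := edge_log (fun s => L (s, 0)) (fun s => p s - q 0) (by fun_prop) (by fun_prop)
    (fun s => hE s 0) (-Complex.I) (fun s => slit_up (hz _ _) (by simp [eq0, hp0]))
  have e2 := edge_log (fun t => L (1, t)) (fun t => p 1 - q t) (by fun_prop) (by fun_prop)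
    (fun s => hE 1 s) (-Complex.I) (fun s => slit_up (hz _ _) (by simp [ep1, hq1]))
  have e3 := edge_log (fun t => L (0, t)) (fun t => p 0 - q t) (by fun_prop) (by fun_prop)
    (fun s => hE 0 s) (Complex.I) (fun s => slit_down (hz _ _) (by simp [ep0, hq0]))
  have e4 := edge_log (fun s => L (s, 1)) (fun s => p s - q 1) (by fun_prop) (by fun_prop)
    (fun s => hE s 1) (Complex.I) (fun s => slit_down (hz _ _) (by simp [eq1, hp1]))
  have k : Complex.log (-Complex.I * (p 1 - q 1)) - Complex.log (-Complex.I * (p 0 - q 0))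
      = Complex.log (Complex.I * (p 1 - q 1)) - Complex.log (Complex.I * (p 0 - q 0)) := by
    linear_combination e3 + e4 - e1 - e2
  have r1 : p 1 - q 1 = ((d - c : ℝ) : ℂ) := by
    rw [ep1, eq1]; apply Complex.ext <;> simp
  have r0 : p 0 - q 0 = -((b - a : ℝ) : ℂ) := by
    rw [ep0, eq0]; apply Complex.ext <;> simp
  have k' := congrArg Complex.im k
  rw [r1, r0] at k'
  have s1 : -Complex.I * ((d - c : ℝ) : ℂ) = ((d - c : ℝ) : ℂ) * (-Complex.I) := by ring
  have s2 : -Complex.I * -((b - a : ℝ) : ℂ) = ((b - a : ℝ) : ℂ) * Complex.I := by ring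
  have s3 : Complex.I * ((d - c : ℝ) : ℂ) = ((d - c : ℝ) : ℂ) * Complex.I := by ring
  have s4 : Complex.I * -((b - a : ℝ) : ℂ) = ((b - a : ℝ) : ℂ) * (-Complex.I) := by ring
  rw [s1, s2, s3, s4] at k'
  simp only [Complex.sub_im, Complex.log_im, Complex.arg_real_mul _ (sub_pos.2 hab),
    Complex.arg_real_mul _ (sub_pos.2 hcd), Complex.arg_I, Complex.arg_neg_I] at k'
  linarith [Real.pi_pos]

/-- Crossing paths in the strip meet. -/
lemma crossing_strip (U V : Set StripA) (a b c d : ℝ) (hab : a < b) (hcd : c < d)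
    (hU : JoinedIn U (a, zeroI) (d, oneI)) (hV : JoinedIn V (b, zeroI) (c, oneI)) :
    (U ∩ V).Nonempty := by
  obtain ⟨P, hP⟩ := hU
  obtain ⟨Q, hQ⟩ := hV
  let φ : StripA → ℂ := fun x => ⟨x.1, (x.2 : ℝ)⟩
  have hφ : Continuous φ := by
    have : φ = fun x : StripA => (x.1 : ℂ) + ((x.2 : ℝ) : ℂ) * Complex.I := by
      funext x
      apply Complex.ext <;> simp [φ]
    rw [this]
    fun_prop
  obtain ⟨s, t, hst⟩ := crossing_complex (fun t => φ (P.extend t)) (fun t => φ (Q.extend t))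
    (hφ.comp P.continuous_extend) (hφ.comp Q.continuous_extend)
    (fun t => (P.extend t).2.2.1) (fun t => (P.extend t).2.2.2)
    (fun t => (Q.extend t).2.2.1) (fun t => (Q.extend t).2.2.2)
    a b c d hab hcd (by rw [P.extend_zero]; rfl) (by rw [P.extend_one]; rfl)
    (by rw [Q.extend_zero]; rfl) (by rw [Q.extend_one]; rfl)
  have hinj : P.extend s = Q.extend t := by
    have h1 := congrArg Complex.re hst
    have h2 := congrArg Complex.im hst
    exact Prod.ext h1 (Subtype.ext h2)
  refine ⟨P.extend s, ?_, ?_⟩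
  · exact hP _
  · rw [hinj]
    exact hQ _

/-- A half line converging to `e` joins `e` to any of its points. -/
lemma joined_top (γ : ℝ → StripA) (hγ : Continuous γ) (e : StripA)
    (h : Tendsto γ atTop (𝓝 e)) (t : ℝ) : JoinedIn (insert e (range γ)) e (γ t) := by
  apply JoinedIn.ofLine (f := fun u : ℝ => if u ≤ 0 then e else γ (t - 1 + u⁻¹))
  · apply Continuous.continuousOn
    rw [continuous_iff_continuousAt]
    intro x
    rcases lt_trichotomy x 0 with hx | hx | hx
    · apply ContinuousAt.congr (f := fun _ => e) continuousAt_const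
      filter_upwards [Iio_mem_nhds hx] with y hy
      rw [if_pos (le_of_lt hy)]
    · subst hx
      rw [continuousAt_iff_continuous_left'_right']
      constructor
      · apply ContinuousWithinAt.congr (f := fun _ => e) continuousWithinAt_const
        · intro y hy
          rw [if_pos (le_of_lt hy)]
        · simp
      · have : Tendsto (fun u : ℝ => γ (t - 1 + u⁻¹)) (𝓝[>] 0) (𝓝 e) :=
          h.comp (tendsto_atTop_add_const_left _ _ tendsto_inv_nhdsGT_zero)
        unfold ContinuousWithinAt
        simp only [le_refl, if_true]
        apply this.congr'
        filter_upwards [self_mem_nhdsWithin] with y hy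
        rw [if_neg (not_le.2 hy)]
    · have : ContinuousAt (fun u : ℝ => γ (t - 1 + u⁻¹)) x := by
        apply hγ.continuousAt.comp
        exact continuousAt_const.add (continuousAt_inv₀ hx.ne')
      apply this.congr
      filter_upwards [Ioi_mem_nhds hx] with y hy
      rw [if_neg (not_le.2 hy)]
  · simp
  · norm_num
  · rintro _ ⟨u, -, rfl⟩
    dsimp only
    split_ifs
    · exact mem_insert _ _
    · exact mem_insert_of_mem _ (mem_range_self _)

lemma joined_bot (γ : ℝ → StripA) (hγ : Continuous γ) (e : StripA)
    (h : Tendsto γ atBot (𝓝 e)) (t : ℝ) : JoinedIn (insert e (range γ)) e (γ t) := by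
  have := joined_top (fun s => γ (-s)) (hγ.comp continuous_neg) e
    (h.comp tendsto_neg_atTop_atBot) (-t)
  simp only [neg_neg] at this
  apply this.mono
  apply insert_subset_insert
  rintro _ ⟨s, rfl⟩
  exact ⟨-s, rfl⟩

/-- The point `(min, y)` or `(max, y)` is joined to any point of the line. -/
lemma joined_end (γ : ℝ → StripA) (hγ : Continuous γ) (y : Set.Icc (0:ℝ) 1) (a b x : ℝ)
    (hx : x = a ∨ x = b) (ha : Tendsto γ atBot (𝓝 (a, y))) (hb : Tendsto γ atTop (𝓝 (b, y)))
    (z : StripA) (hz : z ∈ range γ) : JoinedIn (insert (x, y) (range γ)) (x, y) z := by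
  obtain ⟨t, rfl⟩ := hz
  rcases hx with rfl | rfl
  · exact joined_bot γ hγ _ ha t
  · exact joined_top γ hγ _ hb t

lemma IsHomeoStar.iter {f : StripA ≃ₜ StripA} (hf : IsHomeoStar f) (n : ℕ) :
    ∃ g : StripA ≃ₜ StripA, IsHomeoStar g ∧ (⇑g) = (⇑f)^[n] := by
  induction n with
  | zero =>
    refine ⟨Homeomorph.refl _, ⟨fun x => rfl, fun x => rfl, fun x y h => h, fun x y h => h⟩, rfl⟩
  | succ n ih =>
    obtain ⟨g, hg, e⟩ := ih
    have hb : ∀ x, f (x, zeroI) = ((f (x, zeroI)).1, zeroI) := fun x =>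
      Prod.ext rfl (hf.maps_bot x)
    have ht : ∀ x, f (x, oneI) = ((f (x, oneI)).1, oneI) := fun x =>
      Prod.ext rfl (hf.maps_top x)
    refine ⟨f.trans g, ⟨fun x => ?_, fun x => ?_, fun x y h => ?_, fun x y h => ?_⟩, ?_⟩
    · rw [Homeomorph.trans_apply, hb]; exact hg.maps_bot _
    · rw [Homeomorph.trans_apply, ht]; exact hg.maps_top _
    · have := hg.mono_bot (hf.mono_bot h)
      simp only [Homeomorph.trans_apply]
      rw [hb x, hb y]; exact this
    · have := hg.mono_top (hf.mono_top h)
      simp only [Homeomorph.trans_apply]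
      rw [ht x, ht y]; exact this
    · rw [Function.iterate_succ, ← e]; rfl

/-- The restriction of the homeomorphism to a boundary line is onto. -/
lemma surj_line (f : StripA ≃ₜ StripA) (k : Set.Icc (0:ℝ) 1)
    (hm : ∀ x : ℝ, (f (x, k)).2 = k) (hs : StrictMono fun x : ℝ => (f (x, k)).1) (y : ℝ) :
    ∃ x : ℝ, f (x, k) = (y, k) := by
  set u : ℝ → ℝ := fun x => (f (x, k)).1 with hu
  have hcu : Continuous u := by
    have : Continuous fun x : ℝ => f (x, k) := f.continuous.comp (by fun_prop)
    exact continuous_fst.comp this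
  have hcl : IsClosed (range u) := by
    have h1 : IsClosed (f '' (Prod.snd ⁻¹' {k})) :=
      f.isClosedMap _ (isClosed_singleton.preimage continuous_snd)
    have h2 : range u = (fun y : ℝ => ((y, k) : StripA)) ⁻¹' (f '' (Prod.snd ⁻¹' {k})) := by
      ext y
      constructor
      · rintro ⟨x, rfl⟩
        exact ⟨(x, k), rfl, Prod.ext rfl (hm x)⟩
      · rintro ⟨⟨x, k'⟩, hk, he⟩
        have hk' : k' = k := hk
        subst hk'
        exact ⟨x, congrArg Prod.fst he⟩
    rw [h2]
    exact h1.preimage (by fun_prop)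
  have hne : (range u).Nonempty := range_nonempty u
  have hup : ∃ b, y ≤ u b := by
    by_contra! hb
    have hbd : BddAbove (range u) := ⟨y, by rintro _ ⟨x, rfl⟩; exact (hb x).le⟩
    obtain ⟨x, hx⟩ := hcl.csSup_mem hne hbd
    have h1 : u (x + 1) ≤ sSup (range u) := le_csSup hbd (mem_range_self _)
    have h2 : u x < u (x + 1) := hs (by linarith)
    linarith
  have hlo : ∃ b, u b ≤ y := by
    by_contra! hb
    have hbd : BddBelow (range u) := ⟨y, by rintro _ ⟨x, rfl⟩; exact (hb x).le⟩
    obtain ⟨x, hx⟩ := hcl.csInf_mem hne hbd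
    have h1 : sInf (range u) ≤ u (x - 1) := csInf_le hbd (mem_range_self _)
    have h2 : u (x - 1) < u x := hs (by linarith)
    linarith
  obtain ⟨x, hx⟩ := mem_range_of_exists_le_of_exists_ge hcu hlo hup
  exact ⟨x, Prod.ext hx (hm x)⟩

lemma IsHomeoStar.interior {f : StripA ≃ₜ StripA} (hf : IsHomeoStar f) (z : StripA)
    (hz : 0 < (z.2 : ℝ) ∧ (z.2 : ℝ) < 1) : 0 < ((f z).2 : ℝ) ∧ ((f z).2 : ℝ) < 1 := by
  constructor
  · refine lt_of_le_of_ne (f z).2.2.1 fun h => ?_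
    obtain ⟨x, hx⟩ := surj_line f zeroI hf.maps_bot hf.mono_bot (f z).1
    have h1 : f (x, zeroI) = f z := hx.trans (Prod.ext rfl (Subtype.ext h))
    have h2 := f.injective h1
    rw [← h2] at hz
    exact lt_irrefl _ hz.1
  · refine lt_of_le_of_ne (f z).2.2.2 fun h => ?_
    obtain ⟨x, hx⟩ := surj_line f oneI hf.maps_top hf.mono_top (f z).1
    have h1 : f (x, oneI) = f z := hx.trans (Prod.ext rfl (Subtype.ext h.symm))
    have h2 := f.injective h1
    rw [← h2] at hz
    exact lt_irrefl _ hz.2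

/-- Lemma 2.8 (forcing lemma).  Let `f ∈ Homeo_*(Ã)`.  Suppose
`λ₀, λ₀' ∈ Ẽ_0`, `λ₁, λ₁' ∈ Ẽ_1`, `n ≥ 1`, `n' ≥ 1` satisfy
`f^n(λ₀) ∩ λ₁ ≠ ∅`, `f^{n'}(λ₀') ∩ λ₁' ≠ ∅`, `f^n(λ₀) ≺ λ₀'`,
`λ₁' ≺ f^{n'}(λ₁)` and `λ₀' ∩ λ₁ = ∅`.  Then `f^{n+n'}(λ₀) ∩ λ₁' ≠ ∅`.
(The ends of `f^n(λ₀)` are the images under `f^n` of the ends of `λ₀`.) -/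
theorem forcing_lemma (f : StripA ≃ₜ StripA) (hf : IsHomeoStar f)
    (lam0 lam0' : E0Line) (lam1 lam1' : E1Line) (n n' : ℕ)
    (hn : 1 ≤ n) (hn' : 1 ≤ n')
    (hmeet : ((⇑f)^[n] '' Set.range lam0.toFun ∩ Set.range lam1.toFun).Nonempty)
    (hmeet' : ((⇑f)^[n'] '' Set.range lam0'.toFun ∩ Set.range lam1'.toFun).Nonempty)
    (hprec0 : PrecData ((⇑f)^[n] '' Set.range lam0.toFun)
      (((⇑f)^[n] (lam0.endNeg, zeroI)).1) (((⇑f)^[n] (lam0.endPos, zeroI)).1)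
      (Set.range lam0'.toFun) lam0'.endNeg lam0'.endPos)
    (hprec1 : PrecData (Set.range lam1'.toFun) lam1'.endNeg lam1'.endPos
      ((⇑f)^[n'] '' Set.range lam1.toFun)
      (((⇑f)^[n'] (lam1.endNeg, oneI)).1) (((⇑f)^[n'] (lam1.endPos, oneI)).1))
    (hdisj : Set.range lam0'.toFun ∩ Set.range lam1.toFun = ∅) :
    ((⇑f)^[n + n'] '' Set.range lam0.toFun ∩ Set.range lam1'.toFun).Nonempty := by
  obtain ⟨g, hg, eg⟩ := hf.iter n'
  obtain ⟨h, hh, eh⟩ := hf.iter n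
  rw [show (⇑f)^[n + n'] = ⇑g ∘ ⇑h by rw [eg, eh, add_comm, Function.iterate_add]]
  rw [← eg] at hmeet' hprec1
  rw [← eh] at hmeet hprec0
  clear eg eh
  obtain ⟨hd0, hmin0, -⟩ := hprec0
  obtain ⟨hd1, -, hmax1⟩ := hprec1
  have hbot : ∀ {k : StripA ≃ₜ StripA}, IsHomeoStar k → ∀ x : ℝ,
      k (x, zeroI) = ((k (x, zeroI)).1, zeroI) := fun hk x => Prod.ext rfl (hk.maps_bot x)
  have htop : ∀ {k : StripA ≃ₜ StripA}, IsHomeoStar k → ∀ x : ℝ,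
      k (x, oneI) = ((k (x, oneI)).1, oneI) := fun hk x => Prod.ext rfl (hk.maps_top x)
  set a0 := min (h (lam0.endNeg, zeroI)).1 (h (lam0.endPos, zeroI)).1 with ha0
  set b0 := max lam0'.endNeg lam0'.endPos with hb0
  set d := max (g (lam1.endNeg, oneI)).1 (g (lam1.endPos, oneI)).1 with hd
  set c := min lam1'.endNeg lam1'.endPos with hc
  have hab : (g (a0, zeroI)).1 < (g (b0, zeroI)).1 :=
    hg.mono_bot (lt_of_lt_of_le hmin0 min_le_max)
  have hcd : c < d := lt_of_le_of_lt min_le_max hmax1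
  -- the four curves joined to their ends
  have J0 : ∀ z ∈ range (fun t => g (h (lam0.toFun t))),
      JoinedIn (insert ((g (a0, zeroI)).1, zeroI) (range (fun t => g (h (lam0.toFun t)))))
        ((g (a0, zeroI)).1, zeroI) z := by
    apply joined_end _ (g.continuous.comp (h.continuous.comp lam0.continuous)) zeroI
      (g ((h (lam0.endNeg, zeroI)).1, zeroI)).1 (g ((h (lam0.endPos, zeroI)).1, zeroI)).1
    · rcases min_choice (h (lam0.endNeg, zeroI)).1 (h (lam0.endPos, zeroI)).1 with e | e
      · left; rw [ha0, e]
      · right; rw [ha0, e]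
    · rw [← hbot hg, ← hbot hh]
      exact ((g.continuous.comp h.continuous).tendsto _).comp lam0.tendsto_neg
    · rw [← hbot hg, ← hbot hh]
      exact ((g.continuous.comp h.continuous).tendsto _).comp lam0.tendsto_pos
  have J0' : ∀ z ∈ range (fun t => g (lam0'.toFun t)),
      JoinedIn (insert ((g (b0, zeroI)).1, zeroI) (range (fun t => g (lam0'.toFun t))))
        ((g (b0, zeroI)).1, zeroI) z := by
    apply joined_end _ (g.continuous.comp lam0'.continuous) zeroI
      (g (lam0'.endNeg, zeroI)).1 (g (lam0'.endPos, zeroI)).1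
    · rcases max_choice lam0'.endNeg lam0'.endPos with e | e
      · left; rw [hb0, e]
      · right; rw [hb0, e]
    · rw [← hbot hg]
      exact (g.continuous.tendsto _).comp lam0'.tendsto_neg
    · rw [← hbot hg]
      exact (g.continuous.tendsto _).comp lam0'.tendsto_pos
  have J1 : ∀ z ∈ range (fun t => g (lam1.toFun t)),
      JoinedIn (insert (d, oneI) (range (fun t => g (lam1.toFun t)))) (d, oneI) z := by
    apply joined_end _ (g.continuous.comp lam1.continuous) oneI
      (g (lam1.endNeg, oneI)).1 (g (lam1.endPos, oneI)).1
    · exact max_choice _ _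
    · rw [← htop hg]
      exact (g.continuous.tendsto _).comp lam1.tendsto_neg
    · rw [← htop hg]
      exact (g.continuous.tendsto _).comp lam1.tendsto_pos
  have J1' : ∀ z ∈ range lam1'.toFun,
      JoinedIn (insert (c, oneI) (range lam1'.toFun)) (c, oneI) z :=
    joined_end _ lam1'.continuous oneI _ _ _ (min_choice _ _) lam1'.tendsto_neg
      lam1'.tendsto_pos
  -- the two crossing paths
  obtain ⟨_, ⟨_, ⟨s, rfl⟩, rfl⟩, t, hst⟩ := hmeet
  obtain ⟨_, ⟨_, ⟨s', rfl⟩, rfl⟩, t', hst'⟩ := hmeet'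
  have JX := ((J0 _ ⟨s, rfl⟩).mono subset_union_left).trans
    ((J1 (g (h (lam0.toFun s))) ⟨t, congrArg g hst⟩).symm.mono subset_union_right)
  have JY := ((J0' _ ⟨s', rfl⟩).mono subset_union_left).trans
    ((J1' (g (lam0'.toFun s')) ⟨t', hst'⟩).symm.mono subset_union_right)
  obtain ⟨z, hzX, hzY⟩ := crossing_strip _ _ _ _ _ _ hab hcd JX JY
  have i0 : ∀ r, _ := fun r => hg.interior _ (hh.interior _ (lam0.mem_interior r))
  have i0' : ∀ r, _ := fun r => hg.interior _ (lam0'.mem_interior r)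
  have i1 : ∀ r, _ := fun r => hg.interior _ (lam1.mem_interior r)
  have i1' := lam1'.mem_interior
  have z0 : ((zeroI : Set.Icc (0:ℝ) 1) : ℝ) = 0 := rfl
  have z1 : ((oneI : Set.Icc (0:ℝ) 1) : ℝ) = 1 := rfl
  have z01 : ∀ x y : ℝ, ((x, zeroI) : StripA) ≠ (y, oneI) := fun x y e => by
    have := congrArg (fun w : StripA => (w.2 : ℝ)) e
    simp only [z0, z1] at this
    norm_num at this
  have nb : ∀ (x : ℝ) (w : StripA), 0 < (w.2 : ℝ) ∧ (w.2 : ℝ) < 1 → w ≠ (x, zeroI) := by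
    rintro x w hw rfl
    exact lt_irrefl _ hw.1
  have nt : ∀ (x : ℝ) (w : StripA), 0 < (w.2 : ℝ) ∧ (w.2 : ℝ) < 1 → w ≠ (x, oneI) := by
    rintro x w hw rfl
    exact lt_irrefl _ hw.2
  rcases hzX with (rfl | ⟨r, rfl⟩) | (rfl | ⟨r, rfl⟩)
  · rcases hzY with (e | ⟨q, e⟩) | (e | ⟨q, e⟩)
    · exact absurd (congrArg Prod.fst e) hab.ne
    · exact absurd e (nb _ _ (i0' q))
    · exact absurd e (z01 _ _)
    · exact absurd e (nb _ _ (i1' q))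
  · rcases hzY with (e | ⟨q, e⟩) | (e | ⟨q, e⟩)
    · exact absurd e (nb _ _ (i0 r))
    · have : h (lam0.toFun r) ∈ h '' range lam0.toFun ∩ range lam0'.toFun :=
        ⟨⟨_, ⟨r, rfl⟩, rfl⟩, q, g.injective e⟩
      rw [hd0] at this
      exact this.elim
    · exact absurd e (nt _ _ (i0 r))
    · exact ⟨_, ⟨_, ⟨r, rfl⟩, rfl⟩, q, e⟩
  · rcases hzY with (e | ⟨q, e⟩) | (e | ⟨q, e⟩)
    · exact absurd e.symm (z01 _ _)
    · exact absurd e (nt _ _ (i0' q))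
    · exact absurd (congrArg Prod.fst e) hcd.ne'
    · exact absurd e (nt _ _ (i1' q))
  · rcases hzY with (e | ⟨q, e⟩) | (e | ⟨q, e⟩)
    · exact absurd e (nb _ _ (i1 r))
    · have : lam0'.toFun q ∈ range lam0'.toFun ∩ range lam1.toFun :=
        ⟨⟨q, rfl⟩, r, (g.injective e).symm⟩
      rw [hdisj] at this
      exact this.elim
    · exact absurd e (nt _ _ (i1 r))
    · have : lam1'.toFun q ∈ range lam1'.toFun ∩ g '' range lam1.toFun :=
        ⟨⟨q, rfl⟩, _, ⟨r, rfl⟩, e.symm⟩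
      rw [hd1] at this
      exact this.elim
end

section
/- Let f̃ ∈ Homeo_*(Ã), Ã = ℝ × [0,1], commute with the translation T : (x,y) ↦ (x+1, y), and let ρ_0 and ρ_1 be the rotation numbers induced by f̃ on ℝ × {0} and ℝ × {1} respectively. Suppose λ_0 ∈ Ẽ_0 and λ_1 ∈ Ẽ_1 satisfy: (1) f̃^n(λ_0) ∩ T^p(λ_0) = ∅ for every n > 0 and p ∈ ℤ; (2) f̃^n(λ_1) ∩ T^p(λ_1) = ∅ for every n > 0 and p ∈ ℤ; (3) f̃^n(λ_1) ∩ T^p(λ_0) = ∅ for every n > 0 and p ∈ ℤ; (4) there exists n_0 ≥ 1 such that f̃^{n_0}(λ_0) ∩ λ_1 ≠ ∅. Then for every p ∈ ℤ and q ≥ 1 satisfying ρ_0·(n_0+q) < p < ρ_1·(n_0+q), or ρ_1·(n_0+q) < p < ρ_0·(n_0+q), one has f̃^{2n_0+q}(λ_0) ∩ T^p(λ_1) ≠ ∅. -/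
open Filter Set Topology

/-- The integer powers `T^p` of the translation `T : (x,y) ↦ (x+1,y)` of the
strip. -/
def Tpow (p : ℤ) : StripA → StripA := fun z => (z.1 + p, z.2)

/-- A path on which `sin ∘ h ≥ 0` cannot leave `[0, π]`. -/
lemma stay_in_Icc (h : ℝ → ℝ) (hc : Continuous h) (hs : ∀ s, 0 ≤ Real.sin (h s))
    (h0 : h 0 ∈ Set.Icc 0 Real.pi) (s : ℝ) : h s ∈ Set.Icc 0 Real.pi := by
  have hpi := Real.pi_pos
  have key : ∀ c : ℝ, Real.sin c < 0 → c ∉ Set.range h := by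
    rintro c hcs ⟨x, rfl⟩
    exact absurd (hs x) (not_le.mpr hcs)
  have hpre : (Set.range h).OrdConnected := (isPreconnected_range hc).ordConnected
  constructor
  · by_contra hlt
    push Not at hlt
    set c := max (h s) (-(Real.pi / 2)) with hcdef
    have hc0 : c < 0 := max_lt hlt (by linarith)
    have hc1 : -Real.pi < c := lt_of_lt_of_le (by linarith) (le_max_right _ _)
    exact key c (Real.sin_neg_of_neg_of_neg_pi_lt hc0 hc1)
      (hpre.out ⟨s, rfl⟩ ⟨0, rfl⟩ ⟨le_max_left _ _, by linarith [h0.1]⟩)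
  · by_contra hlt
    push Not at hlt
    set c := min (h s) (Real.pi + Real.pi / 2) with hcdef
    have hc0 : Real.pi < c := lt_min hlt (by linarith)
    have hc1 : c < 2 * Real.pi := lt_of_le_of_lt (min_le_right _ _) (by linarith)
    refine key c ?_ (hpre.out ⟨0, rfl⟩ ⟨s, rfl⟩ ⟨by linarith [h0.2], min_le_left _ _⟩)
    have := Real.sin_pos_of_pos_of_lt_pi (x := c - Real.pi) (by linarith) (by linarith)
    rw [Real.sin_sub_pi] at this
    linarith

/-- Two paths crossing a strip from bottom to top in opposite orders meet. -/
lemma crossing (x₁ y₁ x₂ y₂ : ℝ → ℝ) (hx₁ : Continuous x₁) (hy₁ : Continuous y₁)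
    (hx₂ : Continuous x₂) (hy₂ : Continuous y₂)
    (b₁ : ∀ s, 0 ≤ y₁ s ∧ y₁ s ≤ 1) (b₂ : ∀ s, 0 ≤ y₂ s ∧ y₂ s ≤ 1)
    (e₁ : y₁ 0 = 0) (e₁' : y₁ 1 = 1) (e₂ : y₂ 0 = 0) (e₂' : y₂ 1 = 1)
    (l0 : x₁ 0 < x₂ 0) (l1 : x₂ 1 < x₁ 1) :
    ∃ s t, x₁ s = x₂ t ∧ y₁ s = y₂ t := by
  by_contra hno
  push Not at hno
  let F : C(ℝ × ℝ, ℂ) :=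
    ⟨fun z => ((x₁ z.1 - x₂ z.2 : ℝ) : ℂ) + ((y₁ z.1 - y₂ z.2 : ℝ) : ℂ) * Complex.I,
      by fun_prop⟩
  have hre : ∀ z, (F z).re = x₁ z.1 - x₂ z.2 := fun z => by simp [F]
  have him : ∀ z, (F z).im = y₁ z.1 - y₂ z.2 := fun z => by simp [F]
  have hne : ∀ z, F z ≠ 0 := by
    intro z hz
    have h1 := hre z
    have h2 := him z
    rw [hz] at h1 h2
    simp only [Complex.zero_re, Complex.zero_im] at h1 h2
    exact hno z.1 z.2 (by linarith) (by linarith)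
  let F' : C(ℝ × ℝ, {z : ℂ // z ≠ 0}) := ⟨fun z => ⟨F z, hne z⟩, by fun_prop⟩
  obtain ⟨L, ⟨hL0, hL⟩, -⟩ := Complex.isCoveringMap_exp.existsUnique_continuousMap_lifts F'
    (a₀ := (0, 0)) (e₀ := Complex.log (F (0, 0)))
    (by apply Subtype.ext; simp [F', Complex.exp_log (hne (0, 0))])
  have hexp : ∀ z, Complex.exp (L z) = F z := fun z => by
    have := congrFun hL z
    exact congrArg Subtype.val this
  have hcos : ∀ z, (F z).re = Real.exp (L z).re * Real.cos (L z).im := fun z => by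
    rw [← hexp, Complex.exp_re]
  have hsin : ∀ z, (F z).im = Real.exp (L z).re * Real.sin (L z).im := fun z => by
    rw [← hexp, Complex.exp_im]
  have hLc : Continuous fun z => (L z).im := Complex.continuous_im.comp L.continuous
  have hpi := Real.pi_pos
  have hstart : (L (0, 0)).im = Real.pi := by
    rw [hL0, Complex.log_im, Complex.arg_eq_pi_iff]
    rw [hre, him]
    exact ⟨by simpa using l0, by simp [e₁, e₂]⟩
  have up : ∀ z, 0 ≤ (F z).im → 0 ≤ Real.sin (L z).im := fun z hz => by
    rw [hsin] at hz
    exact nonneg_of_mul_nonneg_right hz (Real.exp_pos _)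
  have down : ∀ z, (F z).im ≤ 0 → 0 ≤ Real.sin ((L z).im - Real.pi) := fun z hz => by
    rw [hsin] at hz
    rw [Real.sin_sub_pi]
    have := nonpos_of_mul_nonpos_right hz (Real.exp_pos _)
    linarith
  have u1 := stay_in_Icc (fun s => (L (s, 0)).im) (by fun_prop)
    (fun s => up _ (by rw [him]; simp [e₂, b₁])) (by simp [hstart, hpi.le]) 1
  have u2 := stay_in_Icc (fun s => (L (1, s)).im) (by fun_prop)
    (fun s => up _ (by rw [him]; simp [e₁', b₂])) u1 1
  have d1 := stay_in_Icc (fun s => (L (0, s)).im - Real.pi) (by fun_prop)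
    (fun s => down _ (by rw [him]; simp [e₁, b₂])) (by simp [hstart, hpi.le]) 1
  have d2 := stay_in_Icc (fun s => (L (s, 1)).im - Real.pi) (by fun_prop)
    (fun s => down _ (by rw [him]; simp [e₂', b₁])) d1 1
  have hend : (L (1, 1)).im = Real.pi := le_antisymm u2.2 (by linarith [d2.1])
  have := hcos (1, 1)
  rw [hre, hend, Real.cos_pi] at this
  have hp := Real.exp_pos (L (1, 1)).re
  simp only at this
  linarith

/-- Path from the negative end of a line to one of its points. -/
lemma half_path {X : Type*} [TopologicalSpace X] (g : ℝ → X) (hg : Continuous g) (a : X)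
    (ha : Tendsto g atBot (𝓝 a)) (t₀ : ℝ) :
    ∃ P : Path a (g t₀), ∀ s, P s = a ∨ P s ∈ Set.range g := by
  classical
  let c : ℝ → X := fun s => if 0 < s then g (t₀ + 1 - s⁻¹) else a
  have hc : Continuous c := by
    rw [continuous_iff_continuousAt]
    intro s
    rcases lt_trichotomy s 0 with h | h | h
    · have : c =ᶠ[𝓝 s] fun _ => a := by
        filter_upwards [gt_mem_nhds h] with x hx
        simp [c, not_lt.mpr (le_of_lt hx)]
      exact continuousAt_const.congr this.symm
    · subst h
      have h0 : c 0 = a := by simp [c]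
      rw [ContinuousAt, h0]
      rw [← nhdsLE_sup_nhdsGT, tendsto_sup]
      constructor
      · refine tendsto_const_nhds.congr' ?_
        filter_upwards [self_mem_nhdsWithin] with x hx
        simp only [Set.mem_Iic] at hx
        simp [c, not_lt.mpr hx]
      · have h1 : Tendsto (fun s : ℝ => t₀ + 1 - s⁻¹) (𝓝[>] 0) atBot := by
          simp only [sub_eq_add_neg]
          exact tendsto_atBot_add_const_left _ _
            (tendsto_neg_atTop_atBot.comp tendsto_inv_nhdsGT_zero)
        refine (ha.comp h1).congr' ?_
        filter_upwards [self_mem_nhdsWithin] with x hx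
        simp only [Set.mem_Ioi] at hx
        simp [c, hx]
    · have : c =ᶠ[𝓝 s] fun s => g (t₀ + 1 - s⁻¹) := by
        filter_upwards [lt_mem_nhds h] with x hx
        simp [c, hx]
      refine ContinuousAt.congr ?_ this.symm
      refine hg.continuousAt.comp ?_
      exact continuousAt_const.sub (continuousAt_inv₀ h.ne')
  refine ⟨⟨⟨fun s => c s, by fun_prop⟩, by simp [c], by simp [c]⟩, fun s => ?_⟩
  change c s = a ∨ c s ∈ Set.range g
  by_cases h : 0 < (s : ℝ)
  · right; simp [c, h]
  · left; simp [c, h]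

/-- Crossing lemma for paths of the strip. -/
lemma crossing_paths {a₁ a₂ b₁ b₂ : ℝ} (P : Path ((a₁, zeroI) : StripA) (b₁, oneI))
    (Q : Path ((a₂, zeroI) : StripA) (b₂, oneI)) (l0 : a₁ < a₂) (l1 : b₂ < b₁) :
    ∃ s t, P s = Q t := by
  obtain ⟨s, t, hx, hy⟩ := crossing (fun s => (P.extend s).1) (fun s => ((P.extend s).2 : ℝ))
    (fun s => (Q.extend s).1) (fun s => ((Q.extend s).2 : ℝ))
    (continuous_fst.comp P.continuous_extend)
    (continuous_subtype_val.comp (continuous_snd.comp P.continuous_extend))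
    (continuous_fst.comp Q.continuous_extend)
    (continuous_subtype_val.comp (continuous_snd.comp Q.continuous_extend))
    (fun s => (P.extend s).2.2) (fun s => (Q.extend s).2.2)
    (by rw [P.extend_zero]; rfl) (by rw [P.extend_one]; rfl)
    (by rw [Q.extend_zero]; rfl) (by rw [Q.extend_one]; rfl)
    (by simpa using l0) (by simpa using l1)
  have : P.extend s = Q.extend t := Prod.ext hx (Subtype.ext hy)
  obtain ⟨s', hs'⟩ : P.extend s ∈ Set.range P := by
    rw [← P.extend_range]; exact ⟨s, rfl⟩
  obtain ⟨t', ht'⟩ : Q.extend t ∈ Set.range Q := by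
    rw [← Q.extend_range]; exact ⟨t, rfl⟩
  exact ⟨s', t', by rw [hs', ht', this]⟩

lemma Tpow_iter_comm (f : StripA ≃ₜ StripA)
    (hcomm : ∀ z : StripA, f (Tpow 1 z) = Tpow 1 (f z)) (n : ℕ) (p : ℤ) (z : StripA) :
    (⇑f)^[n] (Tpow p z) = Tpow p ((⇑f)^[n] z) := by
  have hadd : ∀ (a b : ℤ) (z : StripA), Tpow (a + b) z = Tpow a (Tpow b z) := by
    intro a b z
    simp only [Tpow, Int.cast_add]
    ext <;> simp; ring
  have h0 : ∀ z : StripA, Tpow 0 z = z := fun z => by simp [Tpow]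
  have hneg : ∀ z, f (Tpow (-1) z) = Tpow (-1) (f z) := by
    intro z
    have := hcomm (Tpow (-1) z)
    rw [← hadd] at this
    norm_num [h0] at this
    rw [this, ← hadd]
    norm_num [h0]
  have h1 : ∀ p z, f (Tpow p z) = Tpow p (f z) := by
    intro p
    induction p using Int.induction_on with
    | zero => intro z; rw [h0, h0]
    | succ i ih => intro z; rw [hadd, ih, hcomm, hadd]
    | pred i ih => intro z; rw [sub_eq_add_neg, hadd, ih, hneg, hadd]
  induction n generalizing z with
  | zero => rfl
  | succ n ih => rw [Function.iterate_succ_apply, h1, ih, Function.iterate_succ_apply]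

/-- Facts about the dynamics on one boundary line. -/
lemma boundary_facts (f : StripA ≃ₜ StripA) (y : Set.Icc (0:ℝ) 1)
    (hm : ∀ x : ℝ, (f (x, y)).2 = y) (hmono : StrictMono fun x : ℝ => (f (x, y)).1)
    (hcomm : ∀ z : StripA, f (Tpow 1 z) = Tpow 1 (f z)) (ρ : ℝ)
    (hρ : ∀ x : ℝ, Tendsto
      (fun n : ℕ => ((fun x : ℝ => (f (x, y)).1)^[n] x) / (n : ℝ)) atTop (𝓝 ρ)) :
    (∀ n z, ((⇑f)^[n] z).2 = y ↔ z.2 = y) ∧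
    (∀ (n : ℕ) (p : ℤ) x, ρ * n < p → ((⇑f)^[n] (x, y)).1 < x + p) ∧
    (∀ (n : ℕ) (p : ℤ) x, (p : ℝ) < ρ * n → x + p < ((⇑f)^[n] (x, y)).1) := by
  let g : CircleDeg1Lift := ⟨⟨fun x : ℝ => (f (x, y)).1, hmono.monotone⟩, fun x => by
    have := hcomm (x, y)
    simp only [Tpow, Int.cast_one] at this
    change (f (x + 1, y)).1 = _
    rw [this]⟩
  have hg : ∀ x, g x = (f (x, y)).1 := fun x => rfl
  have hgc : Continuous g := by
    change Continuous fun x : ℝ => (f (x, y)).1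
    fun_prop
  have hsurj : Function.Surjective g := hgc.surjective g.tendsto_atTop g.tendsto_atBot
  have hf1 : ∀ x, f (x, y) = (g x, y) := fun x => Prod.ext rfl (hm x)
  have hfn : ∀ n x, (⇑f)^[n] (x, y) = ((g^[n]) x, y) := by
    intro n
    induction n with
    | zero => intro x; rfl
    | succ n ih => intro x; rw [Function.iterate_succ_apply, hf1, ih]; rfl
  have hτ : g.translationNumber = ρ := by
    refine tendsto_nhds_unique (?_ : Tendsto (fun n : ℕ => (g^[n] 0) / (n : ℝ)) atTop _) (hρ 0)
    have := g.tendsto_translationNumber 0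
    simpa [CircleDeg1Lift.coe_pow] using this
  have hiff : ∀ z, (f z).2 = y ↔ z.2 = y := by
    intro z
    constructor
    · intro h
      obtain ⟨x, hx⟩ := hsurj (f z).1
      have : f (x, y) = f z := by rw [hf1, hx]; exact Prod.ext rfl h.symm
      rw [← f.injective this]
    · intro h
      have := hm z.1
      rw [← h] at this ⊢
      exact this
  refine ⟨?_, ?_, ?_⟩
  · intro n
    induction n with
    | zero => intro z; rfl
    | succ n ih => intro z; rw [Function.iterate_succ_apply, ih, hiff]
  · intro n p x h
    rw [hfn]
    have := (g ^ n).map_lt_of_translationNumber_lt_int (n := p)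
      (by rw [CircleDeg1Lift.translationNumber_pow, hτ]; linarith) x
    rwa [CircleDeg1Lift.coe_pow] at this
  · intro n p x h
    rw [hfn]
    have := (g ^ n).lt_map_of_int_lt_translationNumber (n := p)
      (by rw [CircleDeg1Lift.translationNumber_pow, hτ]; linarith) x
    rwa [CircleDeg1Lift.coe_pow] at this

/-- Proposition 2.9.  Let `f ∈ Homeo_*(Ã)` commute with `T : (x,y) ↦ (x+1,y)`,
with rotation numbers `ρ₀` and `ρ₁` on `ℝ × {0}` and `ℝ × {1}` respectively.
Suppose `λ₀ ∈ Ẽ_0` and `λ₁ ∈ Ẽ_1` satisfy: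
(1) `f^n(λ₀) ∩ T^p(λ₀) = ∅` for every `n > 0`, `p ∈ ℤ`;
(2) `f^n(λ₁) ∩ T^p(λ₁) = ∅` for every `n > 0`, `p ∈ ℤ`;
(3) `f^n(λ₁) ∩ T^p(λ₀) = ∅` for every `n > 0`, `p ∈ ℤ`;
(4) `f^{n₀}(λ₀) ∩ λ₁ ≠ ∅` for some `n₀ ≥ 1`.
Then, for all `p ∈ ℤ` and `q ≥ 1` with `ρ₀(n₀+q) < p < ρ₁(n₀+q)` or
`ρ₁(n₀+q) < p < ρ₀(n₀+q)`, one has `f^{2n₀+q}(λ₀) ∩ T^p(λ₁) ≠ ∅`. -/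
theorem forcing_with_rotation_numbers (f : StripA ≃ₜ StripA) (hf : IsHomeoStar f)
    (hcomm : ∀ z : StripA, f (Tpow 1 z) = Tpow 1 (f z))
    (ρ₀ ρ₁ : ℝ)
    (hρ₀ : ∀ x : ℝ, Tendsto
      (fun n : ℕ => ((fun y : ℝ => (f (y, zeroI)).1)^[n] x) / (n : ℝ))
      atTop (𝓝 ρ₀))
    (hρ₁ : ∀ x : ℝ, Tendsto
      (fun n : ℕ => ((fun y : ℝ => (f (y, oneI)).1)^[n] x) / (n : ℝ))
      atTop (𝓝 ρ₁))
    (lam0 : E0Line) (lam1 : E1Line)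
    (h1 : ∀ n : ℕ, 0 < n → ∀ p : ℤ,
      (⇑f)^[n] '' Set.range lam0.toFun ∩ Tpow p '' Set.range lam0.toFun = ∅)
    (h2 : ∀ n : ℕ, 0 < n → ∀ p : ℤ,
      (⇑f)^[n] '' Set.range lam1.toFun ∩ Tpow p '' Set.range lam1.toFun = ∅)
    (h3 : ∀ n : ℕ, 0 < n → ∀ p : ℤ,
      (⇑f)^[n] '' Set.range lam1.toFun ∩ Tpow p '' Set.range lam0.toFun = ∅)
    (n₀ : ℕ) (hn₀ : 1 ≤ n₀)
    (h4 : ((⇑f)^[n₀] '' Set.range lam0.toFun ∩ Set.range lam1.toFun).Nonempty)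
    (p : ℤ) (q : ℕ) (hq : 1 ≤ q)
    (hpq : (ρ₀ * (n₀ + q) < p ∧ (p : ℝ) < ρ₁ * (n₀ + q)) ∨
           (ρ₁ * (n₀ + q) < p ∧ (p : ℝ) < ρ₀ * (n₀ + q))) :
    ((⇑f)^[2 * n₀ + q] '' Set.range lam0.toFun ∩
      Tpow p '' Set.range lam1.toFun).Nonempty := by
  obtain ⟨iff0, lt0, gt0⟩ := boundary_facts f zeroI hf.maps_bot hf.mono_bot hcomm ρ₀ hρ₀
  obtain ⟨iff1, lt1, gt1⟩ := boundary_facts f oneI hf.maps_top hf.mono_top hcomm ρ₁ hρ₁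
  have hT := Tpow_iter_comm f hcomm
  have h01 : zeroI ≠ oneI := by
    intro h
    have := congrArg Subtype.val h
    simp [zeroI, oneI] at this
  obtain ⟨w, ⟨_, ⟨t₀, rfl⟩, hw0⟩, ⟨t₁, hw1⟩⟩ := h4
  obtain ⟨P0, hP0⟩ := half_path lam0.toFun lam0.continuous _ lam0.tendsto_neg t₀
  obtain ⟨P1, hP1⟩ := half_path lam1.toFun lam1.continuous _ lam1.tendsto_neg t₁
  have fc : ∀ n, Continuous (⇑f)^[n] := fun n => f.continuous.iterate n
  have tc : ∀ p, Continuous (Tpow p) := fun p => by unfold Tpow; fun_prop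
  set α : ℝ := ((⇑f)^[n₀] (lam0.endNeg, zeroI)).1 with hα
  let b : ℝ := lam1.endNeg
  have hαe : (⇑f)^[n₀] (lam0.endNeg, zeroI) = (α, zeroI) := Prod.ext rfl ((iff0 _ _).2 rfl)
  -- the path from bottom to top
  obtain ⟨γ, hγ⟩ : ∃ γ : Path ((α, zeroI) : StripA) (b, oneI), ∀ s,
      γ s = (α, zeroI) ∨ γ s = (b, oneI) ∨ γ s ∈ (⇑f)^[n₀] '' Set.range lam0.toFun ∨
      γ s ∈ Set.range lam1.toFun := by
    refine ⟨((P0.map (fc n₀)).cast hαe.symm (hw1.trans hw0.symm)).trans P1.symm, fun s => ?_⟩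
    have hs : (((P0.map (fc n₀)).cast hαe.symm (hw1.trans hw0.symm)).trans P1.symm) s ∈
        Set.range (((P0.map (fc n₀)).cast hαe.symm (hw1.trans hw0.symm)).trans P1.symm) :=
      ⟨s, rfl⟩
    rw [Path.trans_range] at hs
    rcases hs with ⟨r, hr⟩ | ⟨r, hr⟩
    · rw [← hr]
      change (⇑f)^[n₀] (P0 r) = _ ∨ (⇑f)^[n₀] (P0 r) = _ ∨ (⇑f)^[n₀] (P0 r) ∈ _ ∨ _
      rcases hP0 r with h | h
      · left; rw [h, hαe]
      · right; right; left; exact ⟨_, h, rfl⟩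
    · rw [← hr]
      change P1 _ = _ ∨ P1 _ = _ ∨ P1 _ ∈ _ ∨ P1 _ ∈ _
      rcases hP1 (unitInterval.symm r) with h | h
      · right; left; exact h
      · right; right; right; exact h
  set N := n₀ + q with hN
  have hNr : ((N : ℕ) : ℝ) = n₀ + q := by push_cast [hN]; rfl
  have eα : (⇑f)^[N] (α, zeroI) = (((⇑f)^[N] (α, zeroI)).1, zeroI) :=
    Prod.ext rfl ((iff0 _ _).2 rfl)
  have eb : (⇑f)^[N] (b, oneI) = (((⇑f)^[N] (b, oneI)).1, oneI) :=
    Prod.ext rfl ((iff1 _ _).2 rfl)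
  let G1 := (γ.map (fc N)).cast eα.symm eb.symm
  let G2 : Path ((α + p, zeroI) : StripA) (b + p, oneI) := γ.map (tc p)
  have hne : ((⇑f)^[N] (α, zeroI)).1 ≠ α + p ∧ ((⇑f)^[N] (b, oneI)).1 ≠ b + p := by
    rw [← hNr] at hpq
    rcases hpq with ⟨ha, hb'⟩ | ⟨ha, hb'⟩
    · exact ⟨(lt0 _ _ _ ha).ne, (gt1 _ _ _ hb').ne'⟩
    · exact ⟨(gt0 _ _ _ hb').ne', (lt1 _ _ _ ha).ne⟩
  obtain ⟨s, t, hst⟩ : ∃ s t, (⇑f)^[N] (γ s) = Tpow p (γ t) := by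
    rw [← hNr] at hpq
    rcases hpq with ⟨ha, hb'⟩ | ⟨ha, hb'⟩
    · obtain ⟨s, t, h⟩ := crossing_paths G1 G2 (lt0 _ _ _ ha) (gt1 _ _ _ hb')
      exact ⟨s, t, h⟩
    · obtain ⟨s, t, h⟩ := crossing_paths G2 G1 (gt0 _ _ _ hb') (lt1 _ _ _ ha)
      exact ⟨t, s, h.symm⟩
  -- heights
  have k0 : (γ s).2 = zeroI ↔ (γ t).2 = zeroI := by
    rw [← iff0 N (γ s), hst]; rfl
  have k1 : (γ s).2 = oneI ↔ (γ t).2 = oneI := by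
    rw [← iff1 N (γ s), hst]; rfl
  have int0 : ∀ z ∈ (⇑f)^[n₀] '' Set.range lam0.toFun, z.2 ≠ zeroI ∧ z.2 ≠ oneI := by
    rintro _ ⟨_, ⟨r, rfl⟩, rfl⟩
    rw [Ne, Ne, iff0, iff1]
    have := lam0.mem_interior r
    constructor <;> intro h <;> rw [h] at this <;> simp [zeroI, oneI] at this
  have int1 : ∀ z ∈ Set.range lam1.toFun, z.2 ≠ zeroI ∧ z.2 ≠ oneI := by
    rintro _ ⟨r, rfl⟩
    have := lam1.mem_interior r
    constructor <;> intro h <;> rw [h] at this <;> simp [zeroI, oneI] at this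
  have c0 : ∀ r, (γ r).2 = zeroI → γ r = (α, zeroI) := by
    intro r hr
    rcases hγ r with h | h | h | h
    · exact h
    · rw [h] at hr; exact absurd hr.symm h01
    · exact absurd hr (int0 _ h).1
    · exact absurd hr (int1 _ h).1
  have c1 : ∀ r, (γ r).2 = oneI → γ r = (b, oneI) := by
    intro r hr
    rcases hγ r with h | h | h | h
    · rw [h] at hr; exact absurd hr h01
    · exact h
    · exact absurd hr (int0 _ h).2
    · exact absurd hr (int1 _ h).2
  have n0 : (γ s).2 ≠ zeroI := by
    intro h
    rw [c0 s h, c0 t (k0.1 h)] at hst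
    exact hne.1 (congrArg Prod.fst hst)
  have n1 : (γ s).2 ≠ oneI := by
    intro h
    rw [c1 s h, c1 t (k1.1 h)] at hst
    exact hne.2 (congrArg Prod.fst hst)
  have n0' := fun h => n0 (k0.2 h)
  have n1' := fun h => n1 (k1.2 h)
  have finj : ∀ n, Function.Injective (⇑f)^[n] := fun n => f.injective.iterate n
  have split : ∀ r, (γ r).2 ≠ zeroI → (γ r).2 ≠ oneI →
      γ r ∈ (⇑f)^[n₀] '' Set.range lam0.toFun ∨ γ r ∈ Set.range lam1.toFun := by
    intro r h0 h1
    rcases hγ r with h | h | h | h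
    · exact absurd (by rw [h]) h0
    · exact absurd (by rw [h]) h1
    · exact Or.inl h
    · exact Or.inr h
  have hNpos : 0 < N := by omega
  rcases split s n0 n1 with ⟨u, hu, hu'⟩ | hs <;> rcases split t n0' n1' with ⟨v, hv, hv'⟩ | ht
  · exfalso
    rw [← hu', ← hv', ← hT, ← Function.iterate_add_apply, Nat.add_comm,
      Function.iterate_add_apply] at hst
    exact Set.eq_empty_iff_forall_notMem.1 (h1 N hNpos p) _
      ⟨⟨u, hu, rfl⟩, ⟨v, hv, (finj _ hst).symm⟩⟩
  · refine ⟨Tpow p (γ t), ⟨u, hu, ?_⟩, ⟨_, ht, rfl⟩⟩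
    rw [← hst, ← hu', ← Function.iterate_add_apply]
    have hi : 2 * n₀ + q = N + n₀ := by omega
    rw [hi]
  · exfalso
    rw [← hv', ← hT, hN, Function.iterate_add_apply] at hst
    exact Set.eq_empty_iff_forall_notMem.1 (h3 q hq p) _
      ⟨⟨_, hs, rfl⟩, ⟨v, hv, (finj _ hst).symm⟩⟩
  · exfalso
    exact Set.eq_empty_iff_forall_notMem.1 (h2 N hNpos p) _
      ⟨⟨_, hs, rfl⟩, ⟨_, ht, hst.symm⟩⟩
end

section
/- Let f be a non wandering homeomorphism of the torus 𝕋² = ℝ²/ℤ², and let f̂ be a homeomorphism of the open annulus 𝕋 × ℝ that lifts f (i.e., π ∘ f̂ = f ∘ π, where π : 𝕋 × ℝ → 𝕋² is the natural covering map) and commutes with the vertical translation V : (x,y) ↦ (x, y+1). Suppose there exists a compact connected essential subset K̂ ⊂ 𝕋 × ℝ invariant by f̂. Then every essential simple loop λ̂ ⊂ 𝕋 × ℝ satisfies f̂(λ̂) ∩ λ̂ ≠ ∅. -/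
open Filter Set Topology Function

/-- The torus `𝕋² = ℝ²/ℤ²`. -/
abbrev Torus2 : Type := AddCircle (1:ℝ) × AddCircle (1:ℝ)

/-- The vertical annulus `𝕋 × ℝ`, an infinite cyclic cover of the torus. -/
abbrev VertAnnulus : Type := AddCircle (1:ℝ) × ℝ

/-- The covering projection `𝕋 × ℝ → 𝕋²`. -/
noncomputable def projVA : VertAnnulus → Torus2 :=
  fun z => (z.1, (z.2 : AddCircle (1:ℝ)))

/-- A compact connected subset `K` of the open annulus `𝕋 × ℝ` is *essential*
if it separates the two ends of `𝕋 × ℝ`, i.e. no connected subset of its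
complement is unbounded both above and below in the second coordinate. -/
def IsEssentialCompactSet (K : Set VertAnnulus) : Prop :=
  IsCompact K ∧ IsConnected K ∧
    ¬ ∃ C : Set VertAnnulus, C ⊆ Kᶜ ∧ IsConnected C ∧
      (∀ M : ℝ, ∃ z ∈ C, M < z.2) ∧ (∀ M : ℝ, ∃ z ∈ C, z.2 < M)


section LogPart

/-- `w` has a continuous logarithm. -/
def HasLog {X : Type*} [TopologicalSpace X] (w : X → ℂ) : Prop :=
  ∃ L : X → ℂ, Continuous L ∧ ∀ s, w s = Complex.exp (L s)

theorem HasLog.mul {X : Type*} [TopologicalSpace X] {w v : X → ℂ} (hw : HasLog w)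
    (hv : HasLog v) : HasLog (fun s => w s * v s) := by
  obtain ⟨L, hL, h1⟩ := hw
  obtain ⟨L', hL', h2⟩ := hv
  exact ⟨fun s => L s + L' s, hL.add hL', fun s => by simp only [h1, h2, Complex.exp_add]⟩

theorem HasLog.inv {X : Type*} [TopologicalSpace X] {w : X → ℂ} (hw : HasLog w) :
    HasLog (fun s => (w s)⁻¹) := by
  obtain ⟨L, hL, h1⟩ := hw
  exact ⟨fun s => - L s, hL.neg, fun s => by simp only [h1, Complex.exp_neg]⟩

theorem HasLog.const {X : Type*} [TopologicalSpace X] {c : ℂ} (hc : c ≠ 0) :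
    HasLog (fun _ : X => c) :=
  ⟨fun _ => Complex.log c, continuous_const, fun _ => (Complex.exp_log hc).symm⟩

theorem HasLog.of_near {X : Type*} [TopologicalSpace X] {w : X → ℂ} (hw : Continuous w)
    (h : ∀ s, ‖w s - 1‖ < 1) : HasLog w := by
  have h1 : ∀ s, w s ∈ Complex.slitPlane := fun s => by
    have := Complex.mem_slitPlane_of_norm_lt_one (h s)
    simpa using this
  refine ⟨fun s => Complex.log (w s), hw.clog h1, fun s => ?_⟩
  rw [Complex.exp_log (Complex.slitPlane_ne_zero (h1 s))]

/-- The embedding of the annulus into the punctured plane. -/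
noncomputable def eVA (z : VertAnnulus) : ℂ :=
  (AddCircle.toCircle z.1 : ℂ) * (Real.exp z.2 : ℂ)

theorem eVA_norm (z : VertAnnulus) : ‖eVA z‖ = Real.exp z.2 := by
  rw [eVA, norm_mul, Circle.norm_coe, one_mul, Complex.norm_real, Real.norm_eq_abs,
    abs_of_pos (Real.exp_pos _)]

theorem eVA_ne (z : VertAnnulus) : eVA z ≠ 0 := by
  rw [← norm_ne_zero_iff, eVA_norm]; exact (Real.exp_pos _).ne'

theorem eVA_cont : Continuous eVA := by
  unfold eVA
  have : Continuous (fun z : VertAnnulus => (AddCircle.toCircle z.1 : ℂ)) :=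
    continuous_subtype_val.comp (AddCircle.continuous_toCircle.comp continuous_fst)
  exact this.mul (by fun_prop)

theorem eVA_inj : Injective eVA := by
  intro z w h
  have h2 : z.2 = w.2 := by
    have := congrArg norm h
    rw [eVA_norm, eVA_norm] at this
    exact Real.exp_injective this
  have h1 : z.1 = w.1 := by
    unfold eVA at h
    rw [h2] at h
    have := mul_right_cancel₀ (by exact_mod_cast (Real.exp_pos _).ne') h
    exact AddCircle.injective_toCircle one_ne_zero (Subtype.ext this)
  exact Prod.ext h1 h2

theorem nullhomotopic_of_hasLog (γ : C(AddCircle (1:ℝ), VertAnnulus))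
    (h : HasLog (fun s => eVA (γ s))) :
    ∃ a : VertAnnulus, ContinuousMap.Homotopic γ (ContinuousMap.const _ a) := by
  obtain ⟨L, hL, h⟩ := h
  replace h : ∀ s, eVA (γ s) = Complex.exp (L s) := h
  set θ : AddCircle (1:ℝ) → ℝ := fun s => (L s).im / (2 * Real.pi) with hθ
  have hθc : Continuous θ := (Complex.continuous_im.comp hL).div_const _
  have key : ∀ s, γ s = (((θ s : ℝ) : AddCircle (1:ℝ)), (γ s).2) := by
    intro s
    apply eVA_inj
    have hn : Real.exp (γ s).2 = Real.exp (L s).re := by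
      rw [← eVA_norm, h, Complex.norm_exp]
    have hn' : (γ s).2 = (L s).re := Real.exp_injective hn
    rw [h]
    simp only [eVA]
    rw [AddCircle.toCircle_apply_mk, Circle.coe_exp, hn', Complex.ofReal_exp, ← Complex.exp_add]
    congr 1
    have : (2 * Real.pi / 1 * θ s) = (L s).im := by
      simp only [hθ]; field_simp
    rw [this]
    conv_lhs => rw [← Complex.re_add_im (L s)]
    ring
  refine ⟨(((0:ℝ) : AddCircle (1:ℝ)), 0), ⟨⟨⟨fun p =>
    ((((1 - (p.1:ℝ)) * θ p.2 : ℝ) : AddCircle (1:ℝ)), (1 - (p.1:ℝ)) * (γ p.2).2), ?_⟩, ?_, ?_⟩⟩⟩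
  · refine Continuous.prodMk ?_ (by fun_prop)
    exact (AddCircle.continuous_mk' (1:ℝ)).comp
      ((continuous_const.sub (continuous_subtype_val.comp continuous_fst)).mul
        (hθc.comp continuous_snd))
  · intro s
    refine Eq.trans ?_ (key s).symm
    simp
  · intro s
    simp

theorem loop_separates (γ : C(AddCircle (1:ℝ), VertAnnulus))
    (hγess : ¬ ∃ a : VertAnnulus,
      ContinuousMap.Homotopic γ (ContinuousMap.const _ a)) :
    ¬ ∃ C : Set VertAnnulus, C ⊆ (range γ)ᶜ ∧ IsConnected C ∧
      (∀ M : ℝ, ∃ z ∈ C, M < z.2) ∧ (∀ M : ℝ, ∃ z ∈ C, z.2 < M) := by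
  rintro ⟨C, hC, hconn, hup, hdown⟩
  apply hγess
  apply nullhomotopic_of_hasLog
  have hec : Continuous (fun s => eVA (γ s)) := eVA_cont.comp γ.continuous
  have hne : ∀ z ∈ C, ∀ s, eVA z - eVA (γ s) ≠ 0 := by
    intro z hz s h0
    exact hC hz ⟨s, (eVA_inj (sub_eq_zero.1 h0)).symm⟩
  have hP : ∀ {x y : VertAnnulus}, x ∈ C → y ∈ C →
      HasLog (fun s => (eVA x - eVA (γ s)) * (eVA y - eVA (γ s))⁻¹) := by
    intro x y hx hy
    refine hconn.isPreconnected.induction₂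
      (fun x y => HasLog (fun s => (eVA x - eVA (γ s)) * (eVA y - eVA (γ s))⁻¹))
      ?_ ?_ ?_ hx hy
    · intro x hx
      have h1 : ∀ᶠ y in 𝓝 x, ∀ s ∈ (univ : Set (AddCircle (1:ℝ))),
          ‖eVA x - eVA y‖ < ‖eVA y - eVA (γ s)‖ := by
        apply isCompact_univ.eventually_forall_of_forall_eventually
        intro s _
        have hc1 : Continuous (fun p : VertAnnulus × AddCircle (1:ℝ) => ‖eVA x - eVA p.1‖) :=
          (continuous_const.sub (eVA_cont.comp continuous_fst)).norm
        have hc2 : Continuous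
            (fun p : VertAnnulus × AddCircle (1:ℝ) => ‖eVA p.1 - eVA (γ p.2)‖) :=
          ((eVA_cont.comp continuous_fst).sub (hec.comp continuous_snd)).norm
        refine (isOpen_lt hc1 hc2).mem_nhds ?_
        simp only [mem_ofPred_eq, sub_self, norm_zero]
        exact norm_pos_iff.2 (hne x hx s)
      filter_upwards [nhdsWithin_le_nhds h1, self_mem_nhdsWithin] with y hy hyC
      apply HasLog.of_near
      · exact (continuous_const.sub hec).mul ((continuous_const.sub hec).inv₀ (hne y hyC))
      · intro s
        have hn := hne y hyC s
        have : (eVA x - eVA (γ s)) * (eVA y - eVA (γ s))⁻¹ - 1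
            = (eVA x - eVA y) / (eVA y - eVA (γ s)) := by
          field_simp; ring
        rw [this, norm_div, div_lt_one (norm_pos_iff.2 hn)]
        exact hy s (mem_univ s)
    · intro x y z hx hy hz h1 h2
      convert h1.mul h2 using 2 with s
      have hn := hne y hy s
      field_simp
    · intro x y hx hy h1
      convert h1.inv using 2 with s
      rw [mul_inv, inv_inv, mul_comm]
  -- bounds
  have hbd : ∃ R : ℝ, ∀ s, |(γ s).2| ≤ R := by
    have := isCompact_univ.exists_bound_of_continuousOn
      (f := fun s => (γ s).2) (continuous_snd.comp γ.continuous).continuousOn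
    obtain ⟨R, hR⟩ := this
    exact ⟨R, fun s => hR s (mem_univ s)⟩
  obtain ⟨R, hR⟩ := hbd
  obtain ⟨u, huC, hu⟩ := hup R
  obtain ⟨d, hdC, hd⟩ := hdown (-R)
  have hU : HasLog (fun s => 1 - eVA (γ s) / eVA u) := by
    apply HasLog.of_near
    · exact continuous_const.sub (hec.div_const _)
    · intro s
      rw [sub_sub_cancel_left, norm_neg, norm_div, eVA_norm, eVA_norm, div_lt_one (Real.exp_pos _)]
      exact Real.exp_lt_exp.2 (lt_of_le_of_lt (abs_le.1 (hR s)).2 hu)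
  have hD : HasLog (fun s => 1 - eVA d / eVA (γ s)) := by
    apply HasLog.of_near
    · exact continuous_const.sub (continuous_const.div hec (fun s => eVA_ne _))
    · intro s
      rw [sub_sub_cancel_left, norm_neg, norm_div, eVA_norm, eVA_norm, div_lt_one (Real.exp_pos _)]
      exact Real.exp_lt_exp.2 (lt_of_lt_of_le hd (abs_le.1 (hR s)).1)
  have hc : HasLog (fun _ : AddCircle (1:ℝ) => - eVA u) := HasLog.const (neg_ne_zero.2 (eVA_ne u))
  have := ((hP hdC huC).mul (hU.mul hc)).mul hD.inv
  convert this using 2 with s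
  have h1 := hne u huC s
  have h2 := hne d hdC s
  have h3 := eVA_ne u
  have h4 := eVA_ne (γ s)
  have h5 : 1 - eVA d / eVA (γ s) = -(eVA d - eVA (γ s)) / eVA (γ s) := by field_simp; ring
  have h6 : 1 - eVA (γ s) / eVA u = (eVA u - eVA (γ s)) / eVA u := by field_simp
  rw [h5, h6]
  field_simp

end LogPart

section Sep

instance instLCAddCircle : LocallyConnectedSpace (AddCircle (1:ℝ)) :=
  (QuotientAddGroup.isQuotientMap_mk (G := ℝ)
    (N := AddSubgroup.zmultiples (1:ℝ))).isCoinducing.locallyConnectedSpace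

/-- The union of connected subsets of the complement of `L` going to the end `ε`. -/
def UE (ε : ℝ) (L : Set VertAnnulus) : Set VertAnnulus :=
  {z | ∃ C ⊆ Lᶜ, IsPreconnected C ∧ z ∈ C ∧ ∀ M : ℝ, ∃ w ∈ C, M < ε * w.2}

theorem UE_disj (L : Set VertAnnulus)
    (hL : ¬ ∃ C : Set VertAnnulus, C ⊆ Lᶜ ∧ IsConnected C ∧
      (∀ M : ℝ, ∃ z ∈ C, M < z.2) ∧ (∀ M : ℝ, ∃ z ∈ C, z.2 < M))
    {z : VertAnnulus} (h1 : z ∈ UE 1 L) (h2 : z ∈ UE (-1) L) : False := by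
  obtain ⟨C, hC, hc, hz, hM⟩ := h1
  obtain ⟨D, hD, hd, hz', hM'⟩ := h2
  refine hL ⟨C ∪ D, union_subset hC hD, ⟨⟨z, Or.inl hz⟩, hc.union z hz hz' hd⟩, ?_, ?_⟩
  · intro M
    obtain ⟨w, hw, h⟩ := hM M
    exact ⟨w, Or.inl hw, by linarith⟩
  · intro M
    obtain ⟨w, hw, h⟩ := hM' (-M)
    exact ⟨w, Or.inr hw, by linarith⟩

theorem UE_sub (ε : ℝ) (L : Set VertAnnulus) : UE ε L ⊆ Lᶜ := by
  rintro z ⟨C, hC, -, hz, -⟩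
  exact hC hz

theorem UE_absorb {ε : ℝ} {L C : Set VertAnnulus} (hC : C ⊆ Lᶜ) (hc : IsPreconnected C)
    (h : (C ∩ UE ε L).Nonempty) : C ⊆ UE ε L := by
  obtain ⟨w, hw, D, hD, hd, hwD, hM⟩ := h
  intro z hz
  refine ⟨C ∪ D, union_subset hC hD, hc.union w hw hwD hd, Or.inl hz, fun M => ?_⟩
  obtain ⟨v, hv, h⟩ := hM M
  exact ⟨v, Or.inr hv, h⟩

theorem conn_nbhd {L : Set VertAnnulus} (hL : IsClosed L) {z : VertAnnulus} (hz : z ∉ L) :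
    ∃ B ⊆ Lᶜ, IsOpen B ∧ z ∈ B ∧ IsConnected B :=
  locallyConnectedSpace_iff_subsets_isOpen_isConnected.1 inferInstance z Lᶜ
    (hL.isOpen_compl.mem_nhds hz)

theorem UE_open (ε : ℝ) {L : Set VertAnnulus} (hL : IsClosed L) : IsOpen (UE ε L) := by
  rw [isOpen_iff_mem_nhds]
  intro z hz
  obtain ⟨B, hB, hBo, hzB, hBc⟩ := conn_nbhd hL (UE_sub _ _ hz)
  exact mem_of_superset (hBo.mem_nhds hzB) (UE_absorb hB hBc.isPreconnected ⟨z, hzB, hz⟩)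

theorem UE_closure (ε : ℝ) {L : Set VertAnnulus} (hL : IsClosed L) :
    closure (UE ε L) ⊆ UE ε L ∪ L := by
  intro z hz
  by_cases hzL : z ∈ L
  · exact Or.inr hzL
  obtain ⟨B, hB, hBo, hzB, hBc⟩ := conn_nbhd hL hzL
  exact Or.inl (UE_absorb hB hBc.isPreconnected (mem_closure_iff.1 hz B hBo hzB) hzB)

theorem half_conn (ε : ℝ) (M : ℝ) : IsPreconnected {z : VertAnnulus | M < ε * z.2} := by
  have h : {z : VertAnnulus | M < ε * z.2} = univ ×ˢ {y : ℝ | M < ε * y} := by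
    ext z; simp
  rw [h]
  refine isPreconnected_univ.prod ?_
  have : Convex ℝ {y : ℝ | M < ε * y} := by
    have := (convex_Ioi M).linear_preimage (LinearMap.mulLeft ℝ ε)
    exact this
  exact this.isPreconnected

theorem half_sub_UE {ε : ℝ} (hε : ε = 1 ∨ ε = -1) {M : ℝ} {L : Set VertAnnulus}
    (hM : ∀ z ∈ L, ε * z.2 ≤ M) : {z : VertAnnulus | M < ε * z.2} ⊆ UE ε L := by
  intro z hz
  refine ⟨_, ?_, half_conn ε M, hz, ?_⟩
  · intro w hw hwL
    exact absurd (hM w hwL) (not_le.2 hw)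
  · intro M'
    have h2 : ε * ε = 1 := by rcases hε with rfl | rfl <;> norm_num
    have h3 : ε * (ε * (max M M' + 1)) = max M M' + 1 := by rw [← mul_assoc, h2, one_mul]
    refine ⟨(0, ε * (max M M' + 1)), ?_, ?_⟩
    · simp only [mem_ofPred_eq, h3]
      linarith [le_max_left M M']
    · simp only [h3]
      linarith [le_max_right M M']

theorem compact_bound {L : Set VertAnnulus} (hL : IsCompact L) :
    ∃ R : ℝ, ∀ z ∈ L, |z.2| ≤ R := by
  obtain ⟨R, hR⟩ := hL.exists_bound_of_continuousOn (f := fun z : VertAnnulus => z.2)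
    continuous_snd.continuousOn
  exact ⟨R, hR⟩

theorem eps_le {ε : ℝ} (hε : ε = 1 ∨ ε = -1) (y : ℝ) : ε * y ≤ |y| := by
  rcases hε with rfl | rfl
  · simpa using le_abs_self y
  · simpa using neg_le_abs y

theorem UE_preconn {ε : ℝ} (hε : ε = 1 ∨ ε = -1) {L : Set VertAnnulus} (hL : IsCompact L) :
    IsPreconnected (UE ε L) := by
  obtain ⟨R, hR⟩ := compact_bound hL
  have hH := half_sub_UE hε (fun z hz => (eps_le hε z.2).trans (hR z hz))
  apply isPreconnected_of_forall_pair
  rintro x ⟨C, hC, hc, hx, hM⟩ y ⟨D, hD, hd, hy, hM'⟩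
  obtain ⟨u, hu, huR⟩ := hM R
  obtain ⟨v, hv, hvR⟩ := hM' R
  have hC' : C ⊆ UE ε L := fun z hz => ⟨C, hC, hc, hz, hM⟩
  have hD' : D ⊆ UE ε L := fun z hz => ⟨D, hD, hd, hz, hM'⟩
  refine ⟨C ∪ {z : VertAnnulus | R < ε * z.2} ∪ D,
    union_subset (union_subset hC' hH) hD', Or.inl (Or.inl hx), Or.inr hy, ?_⟩
  exact (hc.union u hu huR (half_conn ε R)).union v (Or.inr hvR) hv hd

/-- If the end-region of `L` misses `L'`, its closure is in the end-region of `L'`. -/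
theorem UE_nested {ε : ℝ} (hε : ε = 1 ∨ ε = -1) {L L' : Set VertAnnulus} (hL : IsCompact L)
    (hLc : IsConnected L) (hLL : Disjoint L L') (hU : Disjoint (UE ε L) L') :
    closure (UE ε L) ⊆ UE ε L' := by
  obtain ⟨R, hR⟩ := compact_bound hL
  have hH := half_sub_UE hε (fun z hz => (eps_le hε z.2).trans (hR z hz))
  have hpt : ∀ M : ℝ, ∃ w ∈ UE ε L, M < ε * w.2 := by
    intro M
    have h2 : ε * ε = 1 := by rcases hε with rfl | rfl <;> norm_num
    have h3 : ε * (ε * (max R M + 1)) = max R M + 1 := by rw [← mul_assoc, h2, one_mul]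
    refine ⟨(0, ε * (max R M + 1)), hH ?_, ?_⟩
    · simp only [mem_ofPred_eq, h3]
      linarith [le_max_left R M]
    · simp only [h3]
      linarith [le_max_right R M]
  intro z hz
  refine ⟨closure (UE ε L), ?_, (UE_preconn hε hL).closure, hz, fun M => ?_⟩
  · intro w hw
    rcases UE_closure ε hL.isClosed hw with h | h
    · exact fun h' => disjoint_left.1 hU h h'
    · exact fun h' => disjoint_left.1 hLL h h'
  · obtain ⟨w, hw, h⟩ := hpt M
    exact ⟨w, subset_closure hw, h⟩

/-- Vertical translation. -/
def Vt (k : ℤ) (z : VertAnnulus) : VertAnnulus := (z.1, z.2 + k)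

theorem Vt_add (k l : ℤ) (z : VertAnnulus) : Vt k (Vt l z) = Vt (k + l) z := by
  simp only [Vt, Int.cast_add]; ext1
  · rfl
  · simp only; ring

theorem Vt_zero (z : VertAnnulus) : Vt 0 z = z := by simp [Vt]

theorem Vt_comm (g : VertAnnulus → VertAnnulus)
    (hcomm : ∀ z : VertAnnulus, g (z.1, z.2 + 1) = ((g z).1, (g z).2 + 1))
    (k : ℤ) (z : VertAnnulus) : g (Vt k z) = Vt k (g z) := by
  have h1 : ∀ z, g (Vt 1 z) = Vt 1 (g z) := fun z => by simpa [Vt] using hcomm z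
  have h2 : ∀ z, g (Vt (-1) z) = Vt (-1) (g z) := fun z => by
    have := h1 (Vt (-1) z)
    rw [Vt_add, add_neg_cancel, Vt_zero] at this
    rw [this, Vt_add, neg_add_cancel, Vt_zero]
  induction k using Int.induction_on generalizing z with
  | zero => simp [Vt_zero]
  | succ n ih => rw [add_comm, ← Vt_add, h1, ih, Vt_add]
  | pred n ih => rw [sub_eq_add_neg, add_comm, ← Vt_add, h2, ih, Vt_add]

theorem Vt_comm_iter (g : VertAnnulus → VertAnnulus)
    (hcomm : ∀ z : VertAnnulus, g (z.1, z.2 + 1) = ((g z).1, (g z).2 + 1))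
    (k : ℤ) (n : ℕ) (z : VertAnnulus) : g^[n] (Vt k z) = Vt k (g^[n] z) := by
  induction n with
  | zero => rfl
  | succ n ih => rw [iterate_succ_apply', iterate_succ_apply', ih, Vt_comm g hcomm]

/-- Bounded vertical displacement. -/
theorem bdd_disp (g : VertAnnulus → VertAnnulus) (hg : Continuous g)
    (hcomm : ∀ z : VertAnnulus, g (z.1, z.2 + 1) = ((g z).1, (g z).2 + 1)) :
    ∃ B : ℝ, ∀ z, |(g z).2 - z.2| ≤ B := by
  obtain ⟨B, hB⟩ := ((isCompact_univ (X := AddCircle (1:ℝ))).prod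
    (isCompact_Icc (a := (0:ℝ)) (b := 1))).exists_bound_of_continuousOn
    (f := fun z : VertAnnulus => (g z).2 - z.2) (by fun_prop)
  refine ⟨B, fun z => ?_⟩
  have := hB (Vt (-⌊z.2⌋) z) ⟨mem_univ _, by
    simp only [Vt, Int.cast_neg, mem_Icc]
    constructor
    · linarith [Int.floor_le z.2]
    · linarith [Int.lt_floor_add_one z.2]⟩
  rw [Vt_comm g hcomm] at this
  simpa [Vt, Real.norm_eq_abs] using this

theorem UE_image_sub {ε : ℝ} (hε : ε = 1 ∨ ε = -1)
    (g : VertAnnulus → VertAnnulus) (hg : Continuous g) (hinj : Injective g)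
    (hcomm : ∀ z : VertAnnulus, g (z.1, z.2 + 1) = ((g z).1, (g z).2 + 1))
    (L : Set VertAnnulus) {z : VertAnnulus} (hz : z ∈ UE ε L) : g z ∈ UE ε (g '' L) := by
  obtain ⟨B, hB⟩ := bdd_disp g hg hcomm
  obtain ⟨C, hC, hc, hz, hM⟩ := hz
  refine ⟨g '' C, ?_, hc.image g hg.continuousOn, mem_image_of_mem g hz, fun M => ?_⟩
  · rintro _ ⟨w, hw, rfl⟩ ⟨v, hv, hvw⟩
    exact hC hw (hinj hvw ▸ hv)
  · obtain ⟨w, hw, h⟩ := hM (M + B)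
    refine ⟨g w, mem_image_of_mem g hw, ?_⟩
    have h1 := abs_le.1 (hB w)
    rcases hε with rfl | rfl <;> linarith [h1.1, h1.2]

theorem symm_comm (g : VertAnnulus ≃ₜ VertAnnulus)
    (hcomm : ∀ z : VertAnnulus, g (z.1, z.2 + 1) = ((g z).1, (g z).2 + 1)) :
    ∀ z : VertAnnulus, g.symm (z.1, z.2 + 1) = ((g.symm z).1, (g.symm z).2 + 1) := by
  intro z
  apply g.injective
  rw [hcomm, g.apply_symm_apply, g.apply_symm_apply]

theorem UE_image {ε : ℝ} (hε : ε = 1 ∨ ε = -1) (g : VertAnnulus ≃ₜ VertAnnulus)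
    (hcomm : ∀ z : VertAnnulus, g (z.1, z.2 + 1) = ((g z).1, (g z).2 + 1))
    (L : Set VertAnnulus) : UE ε (g '' L) = g '' UE ε L := by
  apply Subset.antisymm
  · intro z hz
    have := UE_image_sub hε g.symm g.symm.continuous g.symm.injective (symm_comm g hcomm) _ hz
    rw [← image_comp, g.symm_comp_self, image_id] at this
    exact ⟨_, this, g.apply_symm_apply z⟩
  · rintro _ ⟨z, hz, rfl⟩
    exact UE_image_sub hε g g.continuous g.injective hcomm L hz

/-- Orbits are bounded when there is an invariant essential continuum. -/
theorem orbit_bdd (g : VertAnnulus ≃ₜ VertAnnulus)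
    (hcomm : ∀ z : VertAnnulus, g (z.1, z.2 + 1) = ((g z).1, (g z).2 + 1))
    (K : Set VertAnnulus) (hK : IsEssentialCompactSet K) (hKinv : ⇑g '' K = K) (M : ℝ) :
    ∃ B : ℝ, ∀ z : VertAnnulus, |z.2| ≤ M → ∀ n : ℕ, |(g^[n] z).2| ≤ B := by
  obtain ⟨R, hR⟩ := compact_bound hK.1
  obtain ⟨N, hN⟩ := exists_nat_gt (M + R)
  have side : ∀ ε : ℝ, (ε = 1 ∨ ε = -1) → ∀ w : VertAnnulus, R < ε * w.2 → ∀ n : ℕ,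
      -R ≤ ε * (g^[n] w).2 := by
    intro ε hε w hw n
    have hε' : -ε = 1 ∨ -ε = -1 := by rcases hε with rfl | rfl <;> norm_num
    have hU : ∀ n : ℕ, g^[n] w ∈ UE ε K := by
      intro n
      induction n with
      | zero => exact half_sub_UE hε (fun z hz => (eps_le hε z.2).trans (hR z hz)) hw
      | succ n ih =>
        rw [iterate_succ_apply', ← hKinv, UE_image hε g hcomm]
        exact mem_image_of_mem g ih
    by_contra hlt
    push Not at hlt
    have hU' : g^[n] w ∈ UE (-ε) K :=
      half_sub_UE hε' (fun z hz => (eps_le hε' z.2).trans (hR z hz))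
        (show R < -ε * (g^[n] w).2 by linarith)
    rcases hε with rfl | rfl
    · exact UE_disj K hK.2.2 (hU n) hU'
    · exact UE_disj K hK.2.2 (by simpa using hU') (hU n)
  refine ⟨R + N, fun z hz n => ?_⟩
  have hz' := abs_le.1 hz
  rw [abs_le]
  constructor
  · have := side 1 (Or.inl rfl) (Vt N z) (by simp only [Vt]; push_cast; linarith) n
    rw [Vt_comm_iter g hcomm] at this
    simp only [Vt] at this
    push_cast at this
    linarith
  · have := side (-1) (Or.inr rfl) (Vt (-N) z) (by simp only [Vt]; push_cast; linarith) n
    rw [Vt_comm_iter g hcomm] at this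
    simp only [Vt] at this
    push_cast at this
    linarith

theorem proj_open : IsOpenMap projVA :=
  IsOpenMap.id.prodMap (QuotientAddGroup.isOpenMap_coe (N := AddSubgroup.zmultiples (1:ℝ)))

theorem proj_cont : Continuous projVA :=
  continuous_fst.prodMk ((AddCircle.continuous_mk' (1:ℝ)).comp continuous_snd)

theorem proj_eq {z w : VertAnnulus} (h : projVA z = projVA w) : ∃ k : ℤ, z = Vt k w := by
  have h1 : z.1 = w.1 := congrArg (Prod.fst : Torus2 → _) h
  have h2 : (z.2 : AddCircle (1:ℝ)) = (w.2 : AddCircle (1:ℝ)) := congrArg (Prod.snd : Torus2 → _) h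
  have h3 := QuotientAddGroup.eq_iff_sub_mem.1 h2
  obtain ⟨k, hk⟩ := AddSubgroup.mem_zmultiples_iff.1 h3
  refine ⟨k, Prod.ext h1 ?_⟩
  simp only [Vt]
  have : (k:ℝ) = z.2 - w.2 := by simpa using hk
  linarith

theorem Vt_cont (k : ℤ) : Continuous (Vt k) := by unfold Vt; fun_prop

theorem recur (f : Torus2 ≃ₜ Torus2) (hnw : IsNonWandering ⇑f)
    (g : VertAnnulus ≃ₜ VertAnnulus)
    (hlift : ∀ z : VertAnnulus, projVA (g z) = f (projVA z))
    (P : Set VertAnnulus) (hP : IsOpen P) (hPn : P.Nonempty) :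
    ∃ n : ℕ, 1 ≤ n ∧ ∃ k : ℤ, ∃ Q ⊆ P, IsOpen Q ∧ Q.Nonempty ∧
      ∀ z ∈ Q, ∃ w ∈ P, g^[n] z = Vt k w := by
  obtain ⟨n, hn, _, ⟨z, hz, rfl⟩, w, hw, hwz⟩ := hnw _ (proj_open P hP) (hPn.image projVA)
  have hl : ∀ n : ℕ, projVA (g^[n] z) = f^[n] (projVA z) := by
    intro n
    induction n with
    | zero => rfl
    | succ n ih => rw [iterate_succ_apply', iterate_succ_apply', hlift, ih]
  obtain ⟨k, hk⟩ := proj_eq ((hl n).trans hwz.symm)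
  refine ⟨n, hn, k, P ∩ (fun z => Vt (-k) (g^[n] z)) ⁻¹' P, inter_subset_left,
    hP.inter (hP.preimage ((Vt_cont _).comp (g.continuous.iterate n))), ⟨z, hz, ?_⟩, ?_⟩
  · simp only [mem_preimage, hk, Vt_add, neg_add_cancel, Vt_zero]
    exact hw
  · rintro v ⟨-, hv⟩
    exact ⟨_, hv, by simp only [Vt_add, add_neg_cancel, Vt_zero]⟩

theorem no_wandering (f : Torus2 ≃ₜ Torus2) (hnw : IsNonWandering ⇑f)
    (g : VertAnnulus ≃ₜ VertAnnulus)
    (hlift : ∀ z : VertAnnulus, projVA (g z) = f (projVA z))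
    (hcomm : ∀ z : VertAnnulus, g (z.1, z.2 + 1) = ((g z).1, (g z).2 + 1))
    (O : Set VertAnnulus) (hO : IsOpen O) (hOn : O.Nonempty)
    (hw : ∀ n : ℕ, 1 ≤ n → ∀ z ∈ O, g^[n] z ∉ O)
    (B : ℝ) (hB : ∀ z ∈ O, ∀ n : ℕ, |(g^[n] z).2| ≤ B) : False := by
  have main : ∀ m : ℕ, ∃ (P : Set VertAnnulus) (S : Finset ℤ), P ⊆ O ∧ IsOpen P ∧ P.Nonempty ∧
      S.card = m ∧ ∀ s ∈ S, ∃ n : ℕ, ∀ z ∈ P, ∃ w ∈ O, g^[n] z = Vt s w := by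
    intro m
    induction m with
    | zero => exact ⟨O, ∅, Subset.rfl, hO, hOn, rfl, by simp⟩
    | succ m ih =>
      obtain ⟨P, S, hPO, hPo, hPn, hS, hs⟩ := ih
      obtain ⟨n, hn, k, Q, hQP, hQo, hQn, hQ⟩ := recur f hnw g hlift P hPo hPn
      have hstep : ∀ s ∈ S, ∃ n' : ℕ, 1 ≤ n' ∧ ∀ z ∈ Q, ∃ w ∈ O, g^[n'] z = Vt (k + s) w := by
        intro s hsS
        obtain ⟨n', hn'⟩ := hs s hsS
        refine ⟨n' + n, by omega, fun z hz => ?_⟩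
        obtain ⟨w, hwP, hzw⟩ := hQ z hz
        obtain ⟨v, hvO, hwv⟩ := hn' w hwP
        refine ⟨v, hvO, ?_⟩
        rw [iterate_add_apply, hzw, Vt_comm_iter g hcomm, hwv, Vt_add]
      have h0 : (0:ℤ) ∉ S.map (addLeftEmbedding k) := by
        intro h
        obtain ⟨s, hsS, hks⟩ := Finset.mem_map.1 h
        obtain ⟨n', hn', hh⟩ := hstep s hsS
        obtain ⟨z, hz⟩ := hQn
        obtain ⟨w, hwO, hzw⟩ := hh z hz
        have : k + s = 0 := hks
        rw [this, Vt_zero] at hzw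
        exact hw n' hn' z (hPO (hQP hz)) (hzw ▸ hwO)
      refine ⟨Q, Finset.cons 0 _ h0, hQP.trans hPO, hQo, hQn, by rw [Finset.card_cons, Finset.card_map, hS], ?_⟩
      intro s hsS
      rw [Finset.mem_cons] at hsS
      rcases hsS with rfl | hsS
      · exact ⟨0, fun z hz => ⟨z, hPO (hQP hz), (Vt_zero z).symm⟩⟩
      · obtain ⟨s', hs', rfl⟩ := Finset.mem_map.1 hsS
        obtain ⟨n', -, hh⟩ := hstep s' hs'
        exact ⟨n', hh⟩
  set A : ℕ := ⌈2 * B⌉₊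
  obtain ⟨P, S, hPO, -, ⟨z, hz⟩, hS, hs⟩ := main (2 * A + 2)
  have hsub : S ⊆ Finset.Icc (-(A:ℤ)) A := by
    intro s hsS
    obtain ⟨n, hn⟩ := hs s hsS
    obtain ⟨w, hwO, hzw⟩ := hn z hz
    have h1 := abs_le.1 (hB z (hPO hz) n)
    have h2 := abs_le.1 (hB w hwO 0)
    rw [hzw] at h1
    simp only [Vt, iterate_zero, id] at h1 h2
    have hA : 2 * B ≤ A := Nat.le_ceil _
    rw [Finset.mem_Icc]
    constructor
    · have : (-(A:ℝ)) ≤ s := by linarith [h1.1, h2.2]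
      exact_mod_cast this
    · have : (s:ℝ) ≤ A := by linarith [h1.2, h2.1]
      exact_mod_cast this
  have := Finset.card_le_card hsub
  rw [hS, Int.card_Icc] at this
  omega

end Sep

/-- (From the proof of Proposition 5.1.)  Let `f` be a non wandering
homeomorphism of `𝕋²` and `fhat` a homeomorphism of `𝕋 × ℝ` lifting `f` and
commuting with the vertical translation `V : (x,y) ↦ (x,y+1)`.  If there is a
compact connected essential subset `K ⊆ 𝕋 × ℝ` invariant by `fhat`, then every
essential simple loop `γ` of `𝕋 × ℝ` meets its image: `fhat(γ) ∩ γ ≠ ∅`. -/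
theorem essential_loop_meets_image_of_invariant_essential_continuum
    (f : Torus2 ≃ₜ Torus2) (hnw : IsNonWandering ⇑f)
    (fhat : VertAnnulus ≃ₜ VertAnnulus)
    (hlift : ∀ z : VertAnnulus, projVA (fhat z) = f (projVA z))
    (hcomm : ∀ z : VertAnnulus, fhat (z.1, z.2 + 1) = ((fhat z).1, (fhat z).2 + 1))
    (K : Set VertAnnulus) (hK : IsEssentialCompactSet K)
    (hKinv : ⇑fhat '' K = K)
    (γ : C(AddCircle (1:ℝ), VertAnnulus)) (hγinj : Function.Injective ⇑γ)
    (hγess : ¬ ∃ a : VertAnnulus,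
      ContinuousMap.Homotopic γ (ContinuousMap.const _ a)) :
    (⇑fhat '' Set.range ⇑γ ∩ Set.range ⇑γ).Nonempty := by
  by_contra hne
  rw [not_nonempty_iff_eq_empty] at hne
  set L : Set VertAnnulus := range γ with hLdef
  have hLk : IsCompact L := isCompact_range γ.continuous
  have hLc : IsConnected L := isConnected_range γ.continuous
  have hLess := loop_separates γ hγess
  have hdisj : Disjoint L (fhat '' L) := by
    rw [disjoint_comm, disjoint_iff_inter_eq_empty]; exact hne
  have hex : ∃ ε : ℝ, (ε = 1 ∨ ε = -1) ∧ Disjoint (UE ε L) (fhat '' L) := by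
    by_cases h : Disjoint (UE 1 L) (fhat '' L)
    · exact ⟨1, Or.inl rfl, h⟩
    · refine ⟨-1, Or.inr rfl, ?_⟩
      obtain ⟨z, hz1, hz2⟩ := not_disjoint_iff.1 h
      have hsub : fhat '' L ⊆ UE 1 L :=
        UE_absorb (fun w hw hw' => disjoint_left.1 hdisj hw' hw)
          (hLc.image fhat fhat.continuous.continuousOn).isPreconnected ⟨z, hz2, hz1⟩
      rw [disjoint_left]
      intro w hw hw'
      exact UE_disj L hLess (hsub hw') hw
  obtain ⟨ε, hε, hU⟩ := hex
  have hnest : closure (UE ε L) ⊆ fhat '' UE ε L := by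
    rw [← UE_image hε fhat hcomm]
    exact UE_nested hε hLk hLc hdisj hU
  set U := UE ε L with hUdef
  have hUo : IsOpen U := UE_open ε hLk.isClosed
  have hfUo : IsOpen (fhat '' U) := fhat.isOpenMap U hUo
  have hUn : U.Nonempty := by
    obtain ⟨R, hR⟩ := compact_bound hLk
    refine ⟨(0, ε * (R + 1)), half_sub_UE hε (fun z hz => (eps_le hε z.2).trans (hR z hz)) ?_⟩
    have h2 : ε * ε = 1 := by rcases hε with rfl | rfl <;> norm_num
    simp only [mem_ofPred_eq]
    rw [← mul_assoc, h2]; linarith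
  have hWn : (fhat '' U \ closure U).Nonempty := by
    rw [nonempty_iff_ne_empty]
    intro h
    have heq : closure U = fhat '' U := hnest.antisymm (sdiff_eq_empty.1 h)
    have hcl : IsClopen (fhat '' U) := ⟨heq ▸ isClosed_closure, hfUo⟩
    have huniv := hcl.eq_univ (hUn.image fhat)
    obtain ⟨z, hz⟩ := hLc.nonempty
    have : fhat z ∈ fhat '' U := huniv ▸ mem_univ _
    obtain ⟨w, hw, hwz⟩ := this
    exact UE_sub ε L (fhat.injective hwz ▸ hw) hz
  obtain ⟨z0, hz0⟩ := hWn
  have hback : ∀ (n : ℕ) (z : VertAnnulus), fhat^[n] z ∈ U → z ∈ U := by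
    intro n
    induction n with
    | zero => exact fun z h => h
    | succ n ih =>
      intro z h
      have h1 := ih (fhat z) (by simpa [iterate_succ_apply] using h)
      obtain ⟨w, hw, hwz⟩ := hnest (subset_closure h1)
      exact fhat.injective hwz ▸ hw
  obtain ⟨B, hB⟩ := orbit_bdd fhat hcomm K hK hKinv (|z0.2| + 1)
  refine no_wandering f hnw fhat hlift hcomm
    ((fhat '' U \ closure U) ∩ {z | |z.2| < |z0.2| + 1}) ?_ ⟨z0, hz0, ?_⟩ ?_ B ?_
  · exact (hfUo.sdiff isClosed_closure).inter
      (isOpen_lt (continuous_abs.comp continuous_snd) continuous_const)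
  · simp
  · rintro n hn z ⟨⟨-, hz⟩, -⟩ ⟨⟨⟨w, hw, hwz⟩, -⟩, -⟩
    obtain ⟨m, rfl⟩ : ∃ m, n = m + 1 := ⟨n - 1, by omega⟩
    rw [iterate_succ_apply'] at hwz
    exact hz (subset_closure (hback m z (fhat.injective hwz ▸ hw)))
  · rintro z ⟨-, hz⟩ n
    exact hB z (le_of_lt hz) n
end
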